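/- arXiv:0811.2289 — 3 statements merged into one kernel-verified Lean document; each statement's English description precedes it below -/
import Mathlib

section
/- Let A and B be matrices in SU(2,1), and let φ be the group homomorphism from the free group F₂ on two generators g₁, g₂ into SU(2,1) determined by φ(g₁) = A and φ(g₂) = B. Then for every element w of F₂, the trace of the matrix φ(w) lies in the ℚ-subalgebra of ℂ generated by the ten complex numbers tr A, tr B, tr(AB), tr(A⁻¹B), tr(ABA⁻¹B⁻¹) and their complex conjugates. -/
open Matrix

/-- The matrix of the Hermitian form of signature (2,1) on ℂ³. -/
def formJ : Matrix (Fin 3) (Fin 3) ℂ := Matrix.diagonal ![1, 1, -1]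

/-- A matrix belongs to SU(2,1) iff it has determinant 1 and preserves the form `formJ`. -/
def SU21 (A : Matrix (Fin 3) (Fin 3) ℂ) : Prop :=
  A.det = 1 ∧ Aᴴ * formJ * A = formJ

abbrev M3 := Matrix (Fin 3) (Fin 3) ℂ

/-- Polarized Cayley–Hamilton identity for 3×3 matrices. -/
lemma polCH (X Y Z : M3) :
    X*Y*Z + X*Z*Y + Y*X*Z + Y*Z*X + Z*X*Y + Z*Y*X =
      trace X • (Y*Z + Z*Y) + trace Y • (X*Z + Z*X) + trace Z • (X*Y + Y*X)
      - (trace X * trace Y - trace (X*Y)) • Z - (trace X * trace Z - trace (X*Z)) • Y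
      - (trace Y * trace Z - trace (Y*Z)) • X
      + (trace X * trace Y * trace Z - trace X * trace (Y*Z) - trace Y * trace (X*Z)
        - trace Z * trace (X*Y) + trace (X*Y*Z) + trace (X*Z*Y)) • (1 : M3) := by
  ext i j
  fin_cases i <;> fin_cases j <;>
    simp [Matrix.mul_apply, Matrix.trace_fin_three, Fin.sum_univ_three] <;> ring

lemma adj3 (X : M3) : X * X = trace X • X - trace (adjugate X) • (1 : M3) + adjugate X := by
  ext i j
  fin_cases i <;> fin_cases j <;>
    simp [Matrix.mul_apply, Matrix.trace_fin_three, Fin.sum_univ_three,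
      Matrix.adjugate_fin_three] <;> ring

lemma sq3 {X X' : M3} (hd : X.det = 1) (h : X * X' = 1) :
    X * X = trace X • X - trace X' • (1 : M3) + X' := by
  have : adjugate X = X' := by
    have h1 : adjugate X * X = 1 := by rw [adjugate_mul, hd, one_smul]
    calc adjugate X = adjugate X * (X * X') := by rw [h, mul_one]
      _ = X' := by rw [← mul_assoc, h1, one_mul]
  have h2 := adj3 X
  rwa [this] at h2

lemma sqtr (R : Subalgebra ℚ ℂ) {X X' : M3} (Y : M3) (hd : X.det = 1) (h : X * X' = 1)
    (h1 : trace X ∈ R) (h2 : trace X' ∈ R) (h3 : trace (X * Y) ∈ R) (h4 : trace Y ∈ R)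
    (h5 : trace (X' * Y) ∈ R) : trace (X * (X * Y)) ∈ R := by
  rw [← mul_assoc, sq3 hd h]
  simp only [add_mul, sub_mul, smul_mul_assoc, one_mul, trace_add, trace_sub, trace_smul,
    smul_eq_mul]
  exact R.add_mem (R.sub_mem (R.mul_mem h1 h3) (R.mul_mem h2 h4)) h5

lemma tr_inv_su {A A' : M3} (hA : SU21 A) (h : A * A' = 1) : trace A' = star (trace A) := by
  have hJ : formJ * formJ = 1 := by
    ext i j
    fin_cases i <;> fin_cases j <;> simp [formJ, Matrix.mul_apply, Matrix.diagonal]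
  have h1 : A' = formJ * Aᴴ * formJ := by
    have h2 : formJ * Aᴴ * formJ * A = 1 := by
      rw [mul_assoc, mul_assoc, ← mul_assoc Aᴴ, hA.2, hJ]
    calc A' = (formJ * Aᴴ * formJ * A) * A' := by rw [h2, one_mul]
      _ = _ := by rw [mul_assoc, h, mul_one]
  rw [h1, trace_mul_comm, ← mul_assoc, hJ, one_mul, trace_conjTranspose]

lemma su_mul {A B : M3} (hA : SU21 A) (hB : SU21 B) : SU21 (A * B) := by
  refine ⟨by rw [det_mul, hA.1, hB.1, one_mul], ?_⟩
  rw [conjTranspose_mul]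
  calc Bᴴ * Aᴴ * formJ * (A * B) = Bᴴ * (Aᴴ * formJ * A) * B := by simp only [mul_assoc]
    _ = formJ := by rw [hA.2, hB.2]

lemma su_inv {A A' : M3} (hA : SU21 A) (h : A * A' = 1) : SU21 A' := by
  have hd : A'.det = 1 := by
    have := congrArg det h
    rwa [det_mul, hA.1, one_mul, det_one] at this
  refine ⟨hd, ?_⟩
  have h3 : A'ᴴ * Aᴴ = 1 := by rw [← conjTranspose_mul, h, conjTranspose_one]
  calc A'ᴴ * formJ * A' = A'ᴴ * (Aᴴ * formJ * A) * A' := by rw [hA.2]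
    _ = (A'ᴴ * Aᴴ) * formJ * (A * A') := by simp only [mul_assoc]
    _ = formJ := by rw [h, h3, one_mul, mul_one]

/-- Traces of short words. -/
lemma shortTraces (R : Subalgebra ℚ ℂ) {a A b B : M3} (hda : a.det = 1) (hdb : b.det = 1)
    (haA : a * A = 1) (hbB : b * B = 1)
    (ta : trace a ∈ R) (tA : trace A ∈ R) (tb : trace b ∈ R) (tB : trace B ∈ R)
    (tab : trace (a * b) ∈ R) (tAB : trace (A * B) ∈ R) (tAb : trace (A * b) ∈ R)
    (taB : trace (a * B) ∈ R) (tc : trace (a * (b * (A * B))) ∈ R)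
    (tc' : trace (b * (a * (B * A))) ∈ R) :
    trace (1 : M3) ∈ R ∧ trace (a * a) ∈ R ∧ trace (a * (a * b)) ∈ R ∧
    trace (a * (a * (b * b))) ∈ R ∧ trace (a * (b * (a * b))) ∈ R ∧
    trace (a * (a * (b * (a * b)))) ∈ R ∧ trace (a * (a * (b * (a * (a * b))))) ∈ R ∧
    trace (a * (b * (a * (b * (a * b))))) ∈ R ∧
    trace (a * (a * (b * (b * (a * b))))) ∈ R ∧
    trace (a * (a * (b * (a * (b * b))))) ∈ R := by
  have hAa : A * a = 1 := mul_eq_one_comm.mp haA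
  have hBb : B * b = 1 := mul_eq_one_comm.mp hbB
  have cA : ∀ x : M3, A * (a * x) = x := fun x => by rw [← mul_assoc, hAa, one_mul]
  have ca : ∀ x : M3, a * (A * x) = x := fun x => by rw [← mul_assoc, haA, one_mul]
  have cB : ∀ x : M3, B * (b * x) = x := fun x => by rw [← mul_assoc, hBb, one_mul]
  have cb : ∀ x : M3, b * (B * x) = x := fun x => by rw [← mul_assoc, hbB, one_mul]
  have hdA : A.det = 1 := by
    have := congrArg det haA
    rwa [det_mul, hda, one_mul, det_one] at this
  have hdab : (a * b).det = 1 := by rw [det_mul, hda, hdb, one_mul]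
  have hdaab : (a * (a * b)).det = 1 := by rw [det_mul, hda, hdab, one_mul]
  have habBA : (a * b) * (B * A) = 1 := by simp only [mul_assoc, cb, haA]
  have haabBAA : (a * (a * b)) * (B * (A * A)) = 1 := by simp only [mul_assoc, cb, ca, haA]
  have t1 : trace (1 : M3) ∈ R := by
    have : trace (1 : M3) = 3 := by simp [trace_one]
    rw [this]
    exact ofNat_mem R 3
  have tBA : trace (B * A) ∈ R := by rw [trace_mul_comm]; exact tAB
  have tBa : trace (B * a) ∈ R := by rw [trace_mul_comm]; exact taB
  have tbA : trace (b * A) ∈ R := by rw [trace_mul_comm]; exact tAb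
  have tba : trace (b * a) ∈ R := by rw [trace_mul_comm]; exact tab
  have taa : trace (a * a) ∈ R := by
    have := sqtr R 1 hda haA ta tA (by rwa [mul_one]) t1 (by rwa [mul_one])
    rwa [mul_one] at this
  have tbb : trace (b * b) ∈ R := by
    have := sqtr R 1 hdb hbB tb tB (by rwa [mul_one]) t1 (by rwa [mul_one])
    rwa [mul_one] at this
  have taab : trace (a * (a * b)) ∈ R := sqtr R b hda haA ta tA tab tb tAb
  have tbba : trace (b * (b * a)) ∈ R := sqtr R a hdb hbB tb tB tba ta tBa
  have tabb : trace (a * (b * b)) ∈ R := by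
    rw [trace_mul_comm, mul_assoc]; exact tbba
  have tbbA : trace (b * (b * A)) ∈ R := sqtr R A hdb hbB tb tB tbA tA tBA
  have tAbb : trace (A * (b * b)) ∈ R := by
    rw [trace_mul_comm, mul_assoc]; exact tbbA
  have taabb : trace (a * (a * (b * b))) ∈ R := sqtr R (b * b) hda haA ta tA tabb tbb tAbb
  have tabab : trace (a * (b * (a * b))) ∈ R := by
    have := sqtr R 1 hdab habBA tab tBA (by rwa [mul_one]) t1 (by rwa [mul_one])
    simpa only [mul_one, mul_assoc] using this
  have taba : trace (a * (b * a)) ∈ R := by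
    rw [trace_mul_comm, mul_assoc, trace_mul_comm, mul_assoc]; exact taab
  have tababa : trace (a * (b * (a * (b * a)))) ∈ R := by
    have := sqtr R a hdab habBA tab tBA (by simpa only [mul_assoc] using taba) ta
      (by simpa only [mul_assoc, hAa, mul_one] using tB)
    simpa only [mul_assoc] using this
  have taabab : trace (a * (a * (b * (a * b)))) ∈ R := by
    rw [trace_mul_comm]; simpa only [mul_assoc] using tababa
  have tAAB : trace (A * (A * B)) ∈ R := sqtr R B hdA hAa tA ta tAB tB taB
  have tBAA : trace (B * (A * A)) ∈ R := by
    rw [trace_mul_comm, mul_assoc]; exact tAAB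
  have taabaab : trace (a * (a * (b * (a * (a * b))))) ∈ R := by
    have := sqtr R 1 hdaab haabBAA taab tBAA (by rwa [mul_one]) t1 (by rwa [mul_one])
    simpa only [mul_one, mul_assoc] using this
  have tababab : trace (a * (b * (a * (b * (a * b))))) ∈ R := by
    have := sqtr R (a * b) hdab habBA tab tBA (by simpa only [mul_assoc] using tabab) tab
      (by simpa only [mul_assoc, cA, hBb] using t1)
    simpa only [mul_assoc] using this
  -- words with one inverse
  have tbab : trace (b * (a * b)) ∈ R := by
    rw [trace_mul_comm, mul_assoc]; exact tabb
  have tAbab : trace (A * (b * (a * b))) ∈ R := by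
    have hA : A = a * a - trace a • a + trace A • (1 : M3) := by
      have := sq3 hda haA
      rw [this]; abel
    have : trace (A * (b * (a * b))) = trace (a * (a * (b * (a * b))))
        - trace a * trace (a * (b * (a * b))) + trace A * trace (b * (a * b)) := by
      conv_lhs => rw [hA]
      simp only [add_mul, sub_mul, smul_mul_assoc, one_mul, trace_add, trace_sub, trace_smul,
        smul_eq_mul, mul_assoc]
    rw [this]
    exact R.add_mem (R.sub_mem taabab (R.mul_mem ta tabab)) (R.mul_mem tA tbab)
  have tabbab : trace (a * (b * (b * (a * b)))) ∈ R := by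
    -- cyclically `b * a * b * a * b`
    have h0 : trace (b * (a * (b * (a * b)))) ∈ R := by
      have := sqtr R b (X := b * a) (X' := A * B) (by rw [det_mul, hda, hdb, one_mul])
        (by simp only [mul_assoc, ca, hbB]) tba tAB (by simpa only [mul_assoc] using tbab) tb
        (by simpa only [mul_assoc, hBb, mul_one] using tA)
      simpa only [mul_assoc] using this
    have : a * (b * (b * (a * b))) = (a * b) * (b * (a * b)) := by simp only [mul_assoc]
    rw [this, trace_mul_comm]
    simpa only [mul_assoc] using h0
  have tababb : trace (a * (b * (a * (b * b)))) ∈ R := by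
    have : a * (b * (a * (b * b))) = (a * (b * (a * b))) * b := by simp only [mul_assoc]
    rw [this, trace_mul_comm]
    have : b * (a * (b * (a * b))) = (b * a) * (b * (a * b)) := by simp only [mul_assoc]
    have h2 : a * (b * (b * (a * b))) = (a * b) * (b * (a * b)) := by simp only [mul_assoc]
    rw [h2, trace_mul_comm] at tabbab
    simpa only [mul_assoc] using tabbab
  have tbbab : trace (b * (b * (a * b))) ∈ R := by
    -- `b³ a`
    have h0 : trace (b * (b * (b * a))) ∈ R :=
      sqtr R (b * a) hdb hbB tb tB tbba tba (by rw [cB]; exact ta)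
    have : b * (b * (a * b)) = (b * (b * a)) * b := by simp only [mul_assoc]
    rw [this, trace_mul_comm]; exact h0
  have tbabb : trace (b * (a * (b * b))) ∈ R := by
    have : b * (a * (b * b)) = (b * (a * b)) * b := by simp only [mul_assoc]
    rw [this, trace_mul_comm]; exact tbbab
  have tbabA : trace (b * (a * (b * A))) ∈ R := by
    have : b * (a * (b * A)) = (b * (a * b)) * A := by simp only [mul_assoc]
    rw [this, trace_mul_comm]; exact tAbab
  have tabA : trace (a * (b * A)) ∈ R := by
    rw [trace_mul_comm, mul_assoc, hAa, mul_one]; exact tb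
  have tBabA : trace (B * (a * (b * A))) ∈ R := by
    rw [trace_mul_comm]; simpa only [mul_assoc] using tc
  have tAbbab : trace (A * (b * (b * (a * b)))) ∈ R := by
    have h0 := sqtr R (a * (b * A)) hdb hbB tb tB tbabA tabA tBabA
    rw [trace_mul_comm]
    simpa only [mul_assoc] using h0
  have tAba : trace (A * (b * a)) ∈ R := by
    rw [trace_mul_comm, mul_assoc, haA, mul_one]; exact tb
  have tbAba : trace (b * (A * (b * a))) ∈ R := by
    rw [trace_mul_comm]; 
    have : A * (b * a) * b = A * (b * (a * b)) := by simp only [mul_assoc]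
    rw [this]; exact tAbab
  have tBAba : trace (B * (A * (b * a))) ∈ R := by
    have : B * (A * (b * a)) = (B * A) * (b * a) := by simp only [mul_assoc]
    rw [this, trace_mul_comm]; simpa only [mul_assoc] using tc'
  have tAbabb : trace (A * (b * (a * (b * b)))) ∈ R := by
    have h0 := sqtr R (A * (b * a)) hdb hbB tb tB tbAba tAba tBAba
    have : A * (b * (a * (b * b))) = (A * (b * a)) * (b * b) := by simp only [mul_assoc]
    rw [this, trace_mul_comm]
    simpa only [mul_assoc] using h0
  exact ⟨t1, taa, taab, taabb, tabab, taabab, taabaab, tababab,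
    sqtr R _ hda haA ta tA tabbab tbbab tAbbab,
    sqtr R _ hda haA ta tA tababb tbabb tAbabb⟩

/-- The matrix of a positive word. -/
def Wd (a b : M3) (l : List Bool) : M3 := (l.map (fun x => cond x b a)).prod

lemma Wd_append (a b : M3) (l m : List Bool) : Wd a b (l ++ m) = Wd a b l * Wd a b m := by
  simp [Wd]

lemma Wd_rotate (a b : M3) (l : List Bool) (k : ℕ) :
    trace (Wd a b (l.rotate k)) = trace (Wd a b l) := by
  rw [← List.rotate_mod]
  rcases l.eq_nil_or_concat with h | h
  · subst h; simp
  · have hpos : 0 < l.length := by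
      obtain ⟨_, _, rfl⟩ := h
      simp
    have hk := (Nat.mod_lt k hpos).le
    rw [List.rotate_eq_drop_append_take hk, Wd_append, trace_mul_comm, ← Wd_append,
      List.take_append_drop]

/-- Cyclic normal forms of cube-free short words. -/
def repsW : List (List Bool) :=
  let a := false
  let b := true
  [[], [a], [b], [a,a], [a,b], [b,b], [a,a,b], [b,b,a], [a,a,b,b], [a,b,a,b],
   [a,a,b,a,b], [b,b,a,b,a], [a,a,b,a,a,b], [b,b,a,b,b,a], [a,b,a,b,a,b],
   [a,a,b,b,a,b], [a,a,b,a,b,b]]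

/-- Test for beginning with a cube. -/
def cubeW : List Bool → Bool
  | x :: y :: z :: _ => x == y && y == z
  | _ => false

lemma repsW_spec : ∀ n < 7, ∀ v : Fin n → Bool, ∃ k < 7,
    (List.ofFn v).rotate k ∈ repsW ∨ cubeW ((List.ofFn v).rotate k) = true := by
  decide +kernel

lemma wordTraces (R : Subalgebra ℚ ℂ) {a A b B : M3} (hda : a.det = 1) (hdb : b.det = 1)
    (haA : a * A = 1) (hbB : b * B = 1)
    (ta : trace a ∈ R) (tA : trace A ∈ R) (tb : trace b ∈ R) (tB : trace B ∈ R)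
    (tab : trace (a * b) ∈ R) (tAB : trace (A * B) ∈ R) (tAb : trace (A * b) ∈ R)
    (taB : trace (a * B) ∈ R) (tc : trace (a * (b * (A * B))) ∈ R)
    (tc' : trace (b * (a * (B * A))) ∈ R) :
    ∀ n < 7, ∀ l : List Bool, l.length = n → trace (Wd a b l) ∈ R := by
  have hAa : A * a = 1 := mul_eq_one_comm.mp haA
  have hBb : B * b = 1 := mul_eq_one_comm.mp hbB
  obtain ⟨t1, t2, t3, t4, t5, t6, t7, t8, t9, t10⟩ :=
    shortTraces R hda hdb haA hbB ta tA tb tB tab tAB tAb taB tc tc'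
  obtain ⟨-, s2, s3, s4, s5, s6, s7, s8, s9, s10⟩ :=
    shortTraces R hdb hda hbB haA tb tB ta tA (by rwa [trace_mul_comm]) (by rwa [trace_mul_comm])
      (by rwa [trace_mul_comm]) (by rwa [trace_mul_comm]) tc' tc
  intro n
  induction n using Nat.strong_induction_on with
  | _ n ih =>
  intro hn l hl
  obtain ⟨k, -, hk⟩ := repsW_spec n hn (fun i => l.get (i.cast hl.symm))
  have hof : List.ofFn (fun i : Fin n => l.get (i.cast hl.symm)) = l := by
    subst hl; exact List.ofFn_get l
  rw [hof] at hk
  rw [← Wd_rotate a b l k]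
  have hlen : (l.rotate k).length = n := by rw [List.length_rotate, hl]
  generalize l.rotate k = m at hk hlen
  rcases hk with hk | hk
  · simp only [repsW, List.mem_cons, List.not_mem_nil, or_false] at hk
    rcases hk with rfl | rfl | rfl | rfl | rfl | rfl | rfl | rfl | rfl | rfl | rfl | rfl | rfl |
      rfl | rfl | rfl | rfl <;>
    simp only [Wd, List.map_cons, List.map_nil, List.prod_cons, List.prod_nil, mul_one,
      cond_true, cond_false] <;> with_reducible assumption
  · match m, hk, hlen with
    | x :: y :: z :: m, hk, hlen =>
      simp only [cubeW, Bool.and_eq_true, beq_iff_eq] at hk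
      obtain ⟨rfl, rfl⟩ := hk
      simp only [List.length_cons] at hlen
      have h0 := ih m.length (by omega) (by omega) m rfl
      have h1 := ih (m.length + 1) (by omega) (by omega) (x :: m) rfl
      have h2 := ih (m.length + 2) (by omega) (by omega) (x :: x :: m) rfl
      have e : ∀ (x : Bool) (m : List Bool), Wd a b (x :: m) = cond x b a * Wd a b m :=
        fun x m => by simp [Wd]
      cases x
      · simp only [e, cond_false] at *
        exact sqtr R _ hda haA ta tA h2 h1 (by rw [← mul_assoc, hAa, one_mul]; exact h0)
      · simp only [e, cond_true] at *
        exact sqtr R _ hdb hbB tb tB h2 h1 (by rw [← mul_assoc, hBb, one_mul]; exact h0)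

/-- The symmetric sum of products. -/
def symF {M : Type*} [Ring M] (X Y Z : M) : M :=
  X*Y*Z + X*Z*Y + Y*X*Z + Y*Z*X + Z*X*Y + Z*Y*X

/-- Words of length six reduce modulo symmetric sums. -/
lemma nil6 {M : Type*} [Ring M] [Algebra ℚ M] (P : Submodule ℚ M) (a b : M)
    (h : ∀ i j k p q : ℕ, ∀ u x y z v : List Bool,
      u.length = p → x.length = i + 1 → y.length = j + 1 → z.length = k + 1 → v.length = q →
      p + q + i + j + k = 3 →
      (u.map (fun t => cond t b a)).prod * symF (x.map (fun t => cond t b a)).prod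
        (y.map (fun t => cond t b a)).prod (z.map (fun t => cond t b a)).prod
        * (v.map (fun t => cond t b a)).prod ∈ P) :
    (a*a*b)*(a*a*b) ∈ P ∧
    (a*a*b)*(a*b*a) ∈ P ∧
    (a*b*a)*(a*a*b) ∈ P ∧
    (a*b*a)*(a*b*a) ∈ P ∧
    (a*a*b)*(b*b*a) ∈ P ∧
    (a*a*b)*(b*a*b) ∈ P ∧
    (a*b*a)*(b*b*a) ∈ P ∧
    (a*b*a)*(b*a*b) ∈ P := by
  refine ⟨?_, ?_, ?_, ?_, ?_, ?_, ?_, ?_⟩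
  · have h0 := P.smul_mem (1/6 : ℚ) (h 0 0 2 0 1 [] [false] [false] [false,true,false] [true] rfl rfl rfl rfl rfl rfl)
    have h1 := P.smul_mem (1/3 : ℚ) (h 1 1 0 0 1 [] [false,false] [false,false] [true] [true] rfl rfl rfl rfl rfl rfl)
    have h2 := P.smul_mem (-1/3 : ℚ) (h 0 2 0 0 1 [] [false] [false,false,false] [true] [true] rfl rfl rfl rfl rfl rfl)
    convert (P.add_mem (P.add_mem h0 h1) h2) using 1
    simp only [symF, List.map_cons, List.map_nil, List.prod_cons, List.prod_nil, mul_one, one_mul, cond_true, cond_false, mul_add, add_mul, mul_assoc]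
    module
  · have h0 := P.smul_mem (1/6 : ℚ) (h 0 0 0 1 2 [false] [false] [false] [false] [true,true] rfl rfl rfl rfl rfl rfl)
    have h1 := P.smul_mem (1/2 : ℚ) (h 0 1 1 1 0 [false] [false] [false,true] [false,true] [] rfl rfl rfl rfl rfl rfl)
    have h2 := P.smul_mem (-1/2 : ℚ) (h 0 0 0 2 1 [false,false] [false] [false] [true] [true] rfl rfl rfl rfl rfl rfl)
    convert (P.add_mem (P.add_mem h0 h1) h2) using 1
    simp only [symF, List.map_cons, List.map_nil, List.prod_cons, List.prod_nil, mul_one, one_mul, cond_true, cond_false, mul_add, add_mul, mul_assoc]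
    module
  · have h0 := P.smul_mem (1/6 : ℚ) (h 0 0 0 2 1 [false,true] [false] [false] [false] [true] rfl rfl rfl rfl rfl rfl)
    convert h0 using 1
    simp only [symF, List.map_cons, List.map_nil, List.prod_cons, List.prod_nil, mul_one, one_mul, cond_true, cond_false, mul_add, add_mul, mul_assoc]
    module
  · have h0 := P.smul_mem (1/2 : ℚ) (h 0 1 1 1 0 [false] [false] [true,false] [true,false] [] rfl rfl rfl rfl rfl rfl)
    have h1 := P.smul_mem (1/6 : ℚ) (h 0 0 0 0 3 [] [false] [false] [false] [true,false,true] rfl rfl rfl rfl rfl rfl)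
    have h2 := P.smul_mem (-1/2 : ℚ) (h 0 0 3 0 0 [] [false] [false] [false,true,false,true] [] rfl rfl rfl rfl rfl rfl)
    convert (P.add_mem (P.add_mem h0 h1) h2) using 1
    simp only [symF, List.map_cons, List.map_nil, List.prod_cons, List.prod_nil, mul_one, one_mul, cond_true, cond_false, mul_add, add_mul, mul_assoc]
    module
  · have h0 := P.smul_mem (1/6 : ℚ) (h 0 0 0 2 1 [false,false] [true] [true] [true] [false] rfl rfl rfl rfl rfl rfl)
    convert h0 using 1
    simp only [symF, List.map_cons, List.map_nil, List.prod_cons, List.prod_nil, mul_one, one_mul, cond_true, cond_false, mul_add, add_mul, mul_assoc]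
    module
  · have h0 := P.smul_mem (1/3 : ℚ) (h 0 2 0 1 0 [false] [false] [false,true,true] [true] [] rfl rfl rfl rfl rfl rfl)
    have h1 := P.smul_mem (-1/6 : ℚ) (h 1 0 0 2 0 [false,true] [false,false] [true] [true] [] rfl rfl rfl rfl rfl rfl)
    have h2 := P.smul_mem (1/3 : ℚ) (h 1 0 0 0 2 [] [false,false] [true] [true] [true,false] rfl rfl rfl rfl rfl rfl)
    have h3 := P.smul_mem (-1/3 : ℚ) (h 0 0 0 0 3 [] [false] [false] [true] [true,true,false] rfl rfl rfl rfl rfl rfl)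
    have h4 := P.smul_mem (-1/6 : ℚ) (h 0 0 1 0 2 [] [false] [false] [true,true] [true,false] rfl rfl rfl rfl rfl rfl)
    have h5 := P.smul_mem (-1/3 : ℚ) (h 0 2 1 0 0 [] [false] [false,false,true] [true,true] [] rfl rfl rfl rfl rfl rfl)
    have h6 := P.smul_mem (1/3 : ℚ) (h 0 0 2 1 0 [false] [false] [true] [true,true,false] [] rfl rfl rfl rfl rfl rfl)
    have h7 := P.smul_mem (1/6 : ℚ) (h 0 0 2 0 1 [] [false] [false] [true,true,false] [true] rfl rfl rfl rfl rfl rfl)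
    convert (P.add_mem (P.add_mem (P.add_mem (P.add_mem (P.add_mem (P.add_mem (P.add_mem h0 h1) h2) h3) h4) h5) h6) h7) using 1
    simp only [symF, List.map_cons, List.map_nil, List.prod_cons, List.prod_nil, mul_one, one_mul, cond_true, cond_false, mul_add, add_mul, mul_assoc]
    module
  · have h0 := P.smul_mem (1/3 : ℚ) (h 0 1 0 2 0 [false,true] [false] [false,true] [true] [] rfl rfl rfl rfl rfl rfl)
    have h1 := P.smul_mem (-1/3 : ℚ) (h 0 2 1 0 0 [] [false] [false,true,true] [true,false] [] rfl rfl rfl rfl rfl rfl)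
    have h2 := P.smul_mem (1/6 : ℚ) (h 0 0 2 0 1 [] [false] [false] [true,true,true] [false] rfl rfl rfl rfl rfl rfl)
    have h3 := P.smul_mem (1/3 : ℚ) (h 0 2 0 1 0 [true] [false] [false,false,true] [true] [] rfl rfl rfl rfl rfl rfl)
    have h4 := P.smul_mem (1/6 : ℚ) (h 0 0 3 0 0 [] [false] [false] [true,false,true,true] [] rfl rfl rfl rfl rfl rfl)
    have h5 := P.smul_mem (1/6 : ℚ) (h 0 0 1 2 0 [false,true] [false] [false] [true,true] [] rfl rfl rfl rfl rfl rfl)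
    have h6 := P.smul_mem (-1/3 : ℚ) (h 0 0 3 0 0 [] [false] [true] [true,true,false,false] [] rfl rfl rfl rfl rfl rfl)
    have h7 := P.smul_mem (-1/3 : ℚ) (h 0 2 0 0 1 [] [false] [false,true,false] [true] [true] rfl rfl rfl rfl rfl rfl)
    convert (P.add_mem (P.add_mem (P.add_mem (P.add_mem (P.add_mem (P.add_mem (P.add_mem h0 h1) h2) h3) h4) h5) h6) h7) using 1
    simp only [symF, List.map_cons, List.map_nil, List.prod_cons, List.prod_nil, mul_one, one_mul, cond_true, cond_false, mul_add, add_mul, mul_assoc]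
    module
  · have h0 := P.smul_mem (1/6 : ℚ) (h 1 1 1 0 0 [] [false,true] [false,true] [false,true] [] rfl rfl rfl rfl rfl rfl)
    convert h0 using 1
    simp only [symF, List.map_cons, List.map_nil, List.prod_cons, List.prod_nil, mul_one, one_mul, cond_true, cond_false, mul_add, add_mul, mul_assoc]
    module

/-- The `R`-span of the words of length at most `n`. -/
noncomputable def Pf (R : Subalgebra ℚ ℂ) (a b : M3) (n : ℕ) : Submodule R M3 :=
  Submodule.span R {X | ∃ l : List Bool, l.length ≤ n ∧ X = Wd a b l}

section
variable (R : Subalgebra ℚ ℂ) (a b : M3)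

lemma Pf_word {n : ℕ} (l : List Bool) (h : l.length ≤ n) : Wd a b l ∈ Pf R a b n :=
  Submodule.subset_span ⟨l, h, rfl⟩

lemma Pf_mono {m n : ℕ} (h : m ≤ n) : Pf R a b m ≤ Pf R a b n :=
  Submodule.span_mono (fun _ ⟨l, hl, e⟩ => ⟨l, hl.trans h, e⟩)

lemma Pf_mul_le (m n : ℕ) : Pf R a b m * Pf R a b n ≤ Pf R a b (m + n) := by
  unfold Pf
  rw [Submodule.span_mul_span, Submodule.span_le]
  rintro _ ⟨_, ⟨l, hl, rfl⟩, _, ⟨l', hl', rfl⟩, rfl⟩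
  refine Submodule.subset_span ⟨l ++ l', ?_, ?_⟩
  · rw [List.length_append]; omega
  · exact (Wd_append a b l l').symm

lemma Pf_mul {m n k : ℕ} {X Y : M3} (hX : X ∈ Pf R a b m) (hY : Y ∈ Pf R a b n)
    (h : m + n ≤ k) : X * Y ∈ Pf R a b k :=
  Pf_mono R a b h (Pf_mul_le R a b m n (Submodule.mul_mem_mul hX hY))

lemma Pf_smul {n : ℕ} {c : ℂ} {X : M3} (hc : c ∈ R) (hX : X ∈ Pf R a b n) :
    c • X ∈ Pf R a b n :=
  (Pf R a b n).smul_mem (⟨c, hc⟩ : R) hX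

lemma Pf_symF (hT : ∀ n < 7, ∀ l : List Bool, l.length = n → trace (Wd a b l) ∈ R)
    (i j k n : ℕ) (x y z : List Bool) (hx : x.length = i + 1) (hy : y.length = j + 1)
    (hz : z.length = k + 1) (hs : i + j + k ≤ 3) (hn : i + j + k + 2 ≤ n) :
    symF (Wd a b x) (Wd a b y) (Wd a b z) ∈ Pf R a b n := by
  have T : ∀ l : List Bool, l.length < 7 → trace (Wd a b l) ∈ R := fun l h => hT _ h l rfl
  have W : ∀ l : List Bool, l.length ≤ n → Wd a b l ∈ Pf R a b n := fun l h => Pf_word R a b l h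
  have one : (1 : M3) ∈ Pf R a b n := by
    have := W [] (by simp)
    simpa [Wd] using this
  unfold symF
  rw [polCH]
  simp only [← Wd_append]
  have tx := T x (by omega)
  have ty := T y (by omega)
  have tz := T z (by omega)
  have txy := T (x ++ y) (by rw [List.length_append]; omega)
  have txz := T (x ++ z) (by rw [List.length_append]; omega)
  have tyz := T (y ++ z) (by rw [List.length_append]; omega)
  have txyz := T (x ++ y ++ z) (by simp only [List.length_append]; omega)
  have txzy := T (x ++ z ++ y) (by simp only [List.length_append]; omega)
  refine Submodule.add_mem _ (Submodule.sub_mem _ (Submodule.sub_mem _ (Submodule.sub_mem _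
    (Submodule.add_mem _ (Submodule.add_mem _ ?_ ?_) ?_) ?_) ?_) ?_) ?_
  · exact Pf_smul R a b tx (Submodule.add_mem _ (W _ (by rw [List.length_append]; omega))
      (W _ (by rw [List.length_append]; omega)))
  · exact Pf_smul R a b ty (Submodule.add_mem _ (W _ (by rw [List.length_append]; omega))
      (W _ (by rw [List.length_append]; omega)))
  · exact Pf_smul R a b tz (Submodule.add_mem _ (W _ (by rw [List.length_append]; omega))
      (W _ (by rw [List.length_append]; omega)))
  · exact Pf_smul R a b (R.sub_mem (R.mul_mem tx ty) txy) (W _ (by omega))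
  · exact Pf_smul R a b (R.sub_mem (R.mul_mem tx tz) txz) (W _ (by omega))
  · exact Pf_smul R a b (R.sub_mem (R.mul_mem ty tz) tyz) (W _ (by omega))
  · refine Pf_smul R a b ?_ one
    exact R.add_mem (R.add_mem (R.sub_mem (R.sub_mem (R.sub_mem (R.mul_mem (R.mul_mem tx ty) tz)
      (R.mul_mem tx tyz)) (R.mul_mem ty txz)) (R.mul_mem tz txy)) txyz) txzy

lemma Pf_qsmul {n : ℕ} (c : ℚ) {X : M3} (hX : X ∈ Pf R a b n) : c • X ∈ Pf R a b n := by
  have h : (c : ℂ) ∈ R := by simpa using R.algebraMap_mem c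
  have := Pf_smul R a b h hX
  have e : (c : ℂ) • X = c • X := by
    ext i j
    simp [Rat.smul_def]
  rwa [e] at this

/-- The same span as a rational vector space. -/
noncomputable def PfQ (n : ℕ) : Submodule ℚ M3 where
  carrier := {X | X ∈ Pf R a b n}
  add_mem' := fun h h' => (Pf R a b n).add_mem h h'
  zero_mem' := (Pf R a b n).zero_mem
  smul_mem' := fun c _ h => Pf_qsmul R a b c h

lemma Pf_swap (n : ℕ) : Pf R b a n ≤ Pf R a b n := by
  unfold Pf
  rw [Submodule.span_le]
  rintro _ ⟨l, hl, rfl⟩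
  refine Submodule.subset_span ⟨l.map (!·), by simpa using hl, ?_⟩
  unfold Wd
  rw [List.map_map]
  congr 2
  funext x
  cases x <;> rfl

lemma Pf_nil6 (hT : ∀ n < 7, ∀ l : List Bool, l.length = n → trace (Wd a b l) ∈ R) :
    (a*a*b)*(a*a*b) ∈ Pf R a b 5 ∧ (a*a*b)*(a*b*a) ∈ Pf R a b 5 ∧
    (a*b*a)*(a*a*b) ∈ Pf R a b 5 ∧ (a*b*a)*(a*b*a) ∈ Pf R a b 5 ∧
    (a*a*b)*(b*b*a) ∈ Pf R a b 5 ∧ (a*a*b)*(b*a*b) ∈ Pf R a b 5 ∧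
    (a*b*a)*(b*b*a) ∈ Pf R a b 5 ∧ (a*b*a)*(b*a*b) ∈ Pf R a b 5 := by
  refine nil6 (PfQ R a b 5) a b ?_
  intro i j k p q u x y z v hu hx hy hz hv hs
  have h1 := Pf_symF R a b hT i j k (i + j + k + 2) x y z hx hy hz (by omega) le_rfl
  have h2 := Pf_mul R a b (Pf_mul R a b (Pf_word R a b u le_rfl) h1 le_rfl)
    (Pf_word R a b v le_rfl) (k := 5) (by omega)
  exact h2

/-- Representatives in degree three. -/
def S3 : Set M3 := {a*a*b, a*b*a, b*b*a, b*a*b}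

lemma Pf_cube (hT : ∀ n < 7, ∀ l : List Bool, l.length = n → trace (Wd a b l) ∈ R) :
    a*a*a ∈ Pf R a b 2 ∧ b*a*a + a*b*a + a*a*b ∈ Pf R a b 2 := by
  have h1 := Pf_qsmul R a b (1/6) (Pf_symF R a b hT 0 0 0 2 [false] [false] [false] rfl rfl rfl
    (by omega) (by omega))
  have h2 := Pf_qsmul R a b (1/2) (Pf_symF R a b hT 0 0 0 2 [false] [false] [true] rfl rfl rfl
    (by omega) (by omega))
  constructor
  · convert h1 using 1
    simp only [symF, Wd, List.map_cons, List.map_nil, List.prod_cons, List.prod_nil, mul_one,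
      cond_false]
    module
  · convert h2 using 1
    simp only [symF, Wd, List.map_cons, List.map_nil, List.prod_cons, List.prod_nil, mul_one,
      cond_false, cond_true]
    module

lemma swapT (hT : ∀ n < 7, ∀ l : List Bool, l.length = n → trace (Wd a b l) ∈ R) :
    ∀ n < 7, ∀ l : List Bool, l.length = n → trace (Wd b a l) ∈ R := by
  intro n hn l hl
  have : Wd b a l = Wd a b (l.map (!·)) := by
    unfold Wd
    rw [List.map_map]
    congr 2
    funext x
    cases x <;> rfl
  rw [this]
  exact hT n hn _ (by simpa using hl)

lemma Pf3 (hT : ∀ n < 7, ∀ l : List Bool, l.length = n → trace (Wd a b l) ∈ R) :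
    Pf R a b 3 ≤ Pf R a b 2 ⊔ Submodule.span R (S3 a b) := by
  obtain ⟨c1, c2⟩ := Pf_cube R a b hT
  obtain ⟨d1, d2⟩ := Pf_cube R b a (swapT R a b hT)
  replace d1 := Pf_swap R a b 2 d1
  replace d2 := Pf_swap R a b 2 d2
  set V := Pf R a b 2 ⊔ Submodule.span R (S3 a b) with hV
  have l2 : Pf R a b 2 ≤ V := le_sup_left
  have l3 : ∀ x ∈ S3 a b, x ∈ V := fun x hx =>
    (le_sup_right : _ ≤ V) (Submodule.subset_span hx)
  have w1 : a*a*b ∈ V := l3 _ (by simp [S3])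
  have w2 : a*b*a ∈ V := l3 _ (by simp [S3])
  have w3 : b*b*a ∈ V := l3 _ (by simp [S3])
  have w4 : b*a*b ∈ V := l3 _ (by simp [S3])
  have w5 : b*a*a ∈ V := by
    have := V.sub_mem (V.sub_mem (l2 c2) w2) w1
    convert this using 1; abel
  have w6 : a*b*b ∈ V := by
    have := V.sub_mem (V.sub_mem (l2 d2) w4) w3
    convert this using 1; abel
  have w7 := l2 c1
  have w8 := l2 d1
  rw [Pf, Submodule.span_le]
  rintro _ ⟨l, hl, rfl⟩
  rcases Nat.lt_or_ge l.length 3 with h | h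
  · exact l2 (Pf_word R a b l (by omega))
  · match l, hl, h with
    | [x, y, z], _, _ =>
      have e : Wd a b [x, y, z] = cond x b a * cond y b a * cond z b a := by
        simp [Wd, mul_assoc]
      rw [e]
      cases x <;> cases y <;> cases z <;> simp only [cond_true, cond_false, SetLike.mem_coe] <;>
        with_reducible assumption

lemma Pf6 (hT : ∀ n < 7, ∀ l : List Bool, l.length = n → trace (Wd a b l) ∈ R) :
    Pf R a b 6 ≤ Pf R a b 5 := by
  obtain ⟨c1, c2, c3, c4, c5, c6, c7, c8⟩ := Pf_nil6 R a b hT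
  obtain ⟨d1, d2, d3, d4, d5, d6, d7, d8⟩ := Pf_nil6 R b a (swapT R a b hT)
  have sw := Pf_swap R a b 5
  replace d1 := sw d1
  replace d2 := sw d2
  replace d3 := sw d3
  replace d4 := sw d4
  replace d5 := sw d5
  replace d6 := sw d6
  replace d7 := sw d7
  replace d8 := sw d8
  have S3le : Submodule.span R (S3 a b) ≤ Pf R a b 3 := by
    rw [Submodule.span_le]
    rintro x hx
    simp only [S3, Set.mem_insert_iff, Set.mem_singleton_iff] at hx
    have e : ∀ x y z : Bool, cond x b a * cond y b a * cond z b a ∈ Pf R a b 3 := by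
      intro x y z
      have := Pf_word R a b (n := 3) [x, y, z] le_rfl
      simpa [Wd, mul_assoc] using this
    rcases hx with rfl | rfl | rfl | rfl
    · exact e false false true
    · exact e false true false
    · exact e true true false
    · exact e true false true
  have h36 : Pf R a b 6 ≤ Pf R a b 3 * Pf R a b 3 := by
    conv_lhs => rw [Pf]
    rw [Submodule.span_le]
    rintro _ ⟨l, hl, rfl⟩
    have e : Wd a b l = Wd a b (l.take 3) * Wd a b (l.drop 3) := by
      rw [← Wd_append, List.take_append_drop]
    rw [e]
    exact Submodule.mul_mem_mul (Pf_word R a b _ (by simp))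
      (Pf_word R a b _ (by rw [List.length_drop]; omega))
  have h3 := Pf3 R a b hT
  refine h36.trans ((mul_le_mul' h3 h3).trans ?_)
  rw [Submodule.sup_mul, Submodule.mul_sup, Submodule.mul_sup]
  refine sup_le (sup_le ?_ ?_) (sup_le ?_ ?_)
  · exact (Pf_mul_le R a b 2 2).trans (Pf_mono R a b (by omega))
  · exact (mul_le_mul' le_rfl S3le).trans (Pf_mul_le R a b 2 3)
  · exact (mul_le_mul' S3le le_rfl).trans (Pf_mul_le R a b 3 2)
  · rw [Submodule.span_mul_span, Submodule.span_le]
    rintro _ ⟨x, hx, y, hy, rfl⟩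
    simp only [S3, Set.mem_insert_iff, Set.mem_singleton_iff] at hx hy
    change x * y ∈ Pf R a b 5
    rcases hx with rfl | rfl | rfl | rfl <;> rcases hy with rfl | rfl | rfl | rfl <;>
      with_reducible assumption

end

theorem su21_trace_word_polynomial (A B : GL (Fin 3) ℂ)
    (hA : SU21 (A : Matrix (Fin 3) (Fin 3) ℂ)) (hB : SU21 (B : Matrix (Fin 3) (Fin 3) ℂ))
    (φ : FreeGroup (Fin 2) →* GL (Fin 3) ℂ)
    (hφ₁ : φ (FreeGroup.of 0) = A) (hφ₂ : φ (FreeGroup.of 1) = B) :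
    ∀ w : FreeGroup (Fin 2),
      Matrix.trace (φ w : Matrix (Fin 3) (Fin 3) ℂ) ∈
        Algebra.adjoin ℚ
          ({Matrix.trace (A : Matrix (Fin 3) (Fin 3) ℂ),
            Matrix.trace (B : Matrix (Fin 3) (Fin 3) ℂ),
            Matrix.trace ((A * B : GL (Fin 3) ℂ) : Matrix (Fin 3) (Fin 3) ℂ),
            Matrix.trace ((A⁻¹ * B : GL (Fin 3) ℂ) : Matrix (Fin 3) (Fin 3) ℂ),
            Matrix.trace ((A * B * A⁻¹ * B⁻¹ : GL (Fin 3) ℂ) : Matrix (Fin 3) (Fin 3) ℂ),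
            star (Matrix.trace (A : Matrix (Fin 3) (Fin 3) ℂ)),
            star (Matrix.trace (B : Matrix (Fin 3) (Fin 3) ℂ)),
            star (Matrix.trace ((A * B : GL (Fin 3) ℂ) : Matrix (Fin 3) (Fin 3) ℂ)),
            star (Matrix.trace ((A⁻¹ * B : GL (Fin 3) ℂ) : Matrix (Fin 3) (Fin 3) ℂ)),
            star (Matrix.trace ((A * B * A⁻¹ * B⁻¹ : GL (Fin 3) ℂ) : Matrix (Fin 3) (Fin 3) ℂ))}
            : Set ℂ) := by
  set R := Algebra.adjoin ℚ
          ({Matrix.trace (A : Matrix (Fin 3) (Fin 3) ℂ),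
            Matrix.trace (B : Matrix (Fin 3) (Fin 3) ℂ),
            Matrix.trace ((A * B : GL (Fin 3) ℂ) : Matrix (Fin 3) (Fin 3) ℂ),
            Matrix.trace ((A⁻¹ * B : GL (Fin 3) ℂ) : Matrix (Fin 3) (Fin 3) ℂ),
            Matrix.trace ((A * B * A⁻¹ * B⁻¹ : GL (Fin 3) ℂ) : Matrix (Fin 3) (Fin 3) ℂ),
            star (Matrix.trace (A : Matrix (Fin 3) (Fin 3) ℂ)),
            star (Matrix.trace (B : Matrix (Fin 3) (Fin 3) ℂ)),
            star (Matrix.trace ((A * B : GL (Fin 3) ℂ) : Matrix (Fin 3) (Fin 3) ℂ)),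
            star (Matrix.trace ((A⁻¹ * B : GL (Fin 3) ℂ) : Matrix (Fin 3) (Fin 3) ℂ)),
            star (Matrix.trace ((A * B * A⁻¹ * B⁻¹ : GL (Fin 3) ℂ) : Matrix (Fin 3) (Fin 3) ℂ))}
            : Set ℂ) with hR
  have inv : ∀ g : GL (Fin 3) ℂ, (g : M3) * ((g⁻¹ : GL (Fin 3) ℂ) : M3) = 1 := fun g => by
    rw [← Units.val_mul, mul_inv_cancel, Units.val_one]
  have r1 : trace (A : M3) ∈ R := Algebra.subset_adjoin (by simp)
  have r2 : trace (B : M3) ∈ R := Algebra.subset_adjoin (by simp)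
  have r3 : trace ((A * B : GL (Fin 3) ℂ) : M3) ∈ R := Algebra.subset_adjoin (by simp)
  have r4 : trace ((A⁻¹ * B : GL (Fin 3) ℂ) : M3) ∈ R := Algebra.subset_adjoin (by simp)
  have r5 : trace ((A * B * A⁻¹ * B⁻¹ : GL (Fin 3) ℂ) : M3) ∈ R :=
    Algebra.subset_adjoin (by simp)
  have q1 : star (trace (A : M3)) ∈ R := Algebra.subset_adjoin (by simp)
  have q2 : star (trace (B : M3)) ∈ R := Algebra.subset_adjoin (by simp)
  have q3 : star (trace ((A * B : GL (Fin 3) ℂ) : M3)) ∈ R := Algebra.subset_adjoin (by simp)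
  have q4 : star (trace ((A⁻¹ * B : GL (Fin 3) ℂ) : M3)) ∈ R := Algebra.subset_adjoin (by simp)
  have q5 : star (trace ((A * B * A⁻¹ * B⁻¹ : GL (Fin 3) ℂ) : M3)) ∈ R :=
    Algebra.subset_adjoin (by simp)
  clear_value R
  have sAi := su_inv hA (inv A)
  have sBi := su_inv hB (inv B)
  have sAB : SU21 ((A * B : GL (Fin 3) ℂ) : M3) := su_mul hA hB
  have sAiB : SU21 ((A⁻¹ * B : GL (Fin 3) ℂ) : M3) := su_mul sAi hB
  have sC : SU21 ((A * B * A⁻¹ * B⁻¹ : GL (Fin 3) ℂ) : M3) := su_mul (su_mul sAB sAi) sBi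
  rw [← tr_inv_su hA (inv _)] at q1
  rw [← tr_inv_su hB (inv _)] at q2
  rw [← tr_inv_su sAB (inv _), _root_.mul_inv_rev, Units.val_mul, trace_mul_comm] at q3
  rw [← tr_inv_su sAiB (inv _), _root_.mul_inv_rev, inv_inv, Units.val_mul, trace_mul_comm] at q4
  rw [← tr_inv_su sC (inv _)] at q5
  have e5 : (A * B * A⁻¹ * B⁻¹)⁻¹ = B * (A * (B⁻¹ * A⁻¹)) := by group
  rw [e5] at q5
  have hT := wordTraces R hA.1 hB.1 (inv A) (inv B) r1 q1 r2 q2 r3 q3 r4 q4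
    (by simpa only [Units.val_mul, mul_assoc] using r5)
    (by simpa only [Units.val_mul] using q5)
  have h6 := Pf6 R (A : M3) (B : M3) hT
  have mA : ∀ X ∈ Pf R (A : M3) (B : M3) 5, (A : M3) * X ∈ Pf R (A : M3) (B : M3) 5 := by
    intro X hX
    have : (A : M3) ∈ Pf R (A : M3) (B : M3) 1 := by
      simpa [Wd] using Pf_word R (A : M3) (B : M3) (n := 1) [false] le_rfl
    exact h6 (Pf_mul R _ _ this hX (by omega))
  have mB : ∀ X ∈ Pf R (A : M3) (B : M3) 5, (B : M3) * X ∈ Pf R (A : M3) (B : M3) 5 := by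
    intro X hX
    have : (B : M3) ∈ Pf R (A : M3) (B : M3) 1 := by
      simpa [Wd] using Pf_word R (A : M3) (B : M3) (n := 1) [true] le_rfl
    exact h6 (Pf_mul R _ _ this hX (by omega))
  have minv : ∀ g : GL (Fin 3) ℂ, (g : M3).det = 1 → trace (g : M3) ∈ R →
      trace ((g⁻¹ : GL (Fin 3) ℂ) : M3) ∈ R →
      (∀ X ∈ Pf R (A : M3) (B : M3) 5, (g : M3) * X ∈ Pf R (A : M3) (B : M3) 5) →
      (∀ X ∈ Pf R (A : M3) (B : M3) 5,
        ((g⁻¹ : GL (Fin 3) ℂ) : M3) * X ∈ Pf R (A : M3) (B : M3) 5) := by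
    intro g hd t1 t2 hg X hX
    have hh := sq3 hd (inv g)
    have e : ((g⁻¹ : GL (Fin 3) ℂ) : M3) = (g : M3) * (g : M3) - trace (g : M3) • (g : M3)
        + trace ((g⁻¹ : GL (Fin 3) ℂ) : M3) • (1 : M3) := by
      rw [hh]; abel
    rw [e, add_mul, sub_mul, smul_mul_assoc, smul_mul_assoc, one_mul, mul_assoc]
    exact Submodule.add_mem _ (Submodule.sub_mem _ (hg _ (hg _ hX))
      (Pf_smul R _ _ t1 (hg _ hX))) (Pf_smul R _ _ t2 hX)
  have key : ∀ w : FreeGroup (Fin 2), ∀ X ∈ Pf R (A : M3) (B : M3) 5,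
      (φ w : M3) * X ∈ Pf R (A : M3) (B : M3) 5 := by
    intro w
    induction w using FreeGroup.induction_on with
    | C1 => intro X hX; simpa using hX
    | of i =>
      fin_cases i
      · change ∀ X ∈ _, (φ (FreeGroup.of 0) : M3) * X ∈ _
        rw [hφ₁]; exact mA
      · change ∀ X ∈ _, (φ (FreeGroup.of 1) : M3) * X ∈ _
        rw [hφ₂]; exact mB
    | inv_of i _ =>
      fin_cases i
      · change ∀ X ∈ _, (φ (FreeGroup.of 0)⁻¹ : M3) * X ∈ _
        rw [map_inv, hφ₁]; exact minv A hA.1 r1 q1 mA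
      · change ∀ X ∈ _, (φ (FreeGroup.of 1)⁻¹ : M3) * X ∈ _
        rw [map_inv, hφ₂]; exact minv B hB.1 r2 q2 mB
    | mul x y hx hy =>
      intro X hX
      rw [map_mul, Units.val_mul, mul_assoc]
      exact hx _ (hy _ hX)
  intro w
  have h1 : (1 : M3) ∈ Pf R (A : M3) (B : M3) 5 := by
    simpa [Wd] using Pf_word R (A : M3) (B : M3) (n := 5) [] (by simp)
  have h2 := key w 1 h1
  rw [mul_one] at h2
  generalize (φ w : M3) = X at h2
  unfold Pf at h2
  induction h2 using Submodule.span_induction with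
  | mem x h => obtain ⟨l, hl, rfl⟩ := h; exact hT _ (by omega) l rfl
  | zero => rw [trace_zero]; exact R.zero_mem
  | add x y _ _ hx hy => rw [trace_add]; exact R.add_mem hx hy
  | smul c x _ hx =>
    have : trace (c • x) = (c : ℂ) * trace x := by
      rw [← smul_eq_mul, ← trace_smul]; rfl
    rw [this]; exact R.mul_mem c.2 hx
end

section
/- Let A and B be matrices in SU(2,1) and set a = tr A, b = tr B, c = tr(AB), d = tr(A⁻¹B). Then the square of the imaginary part of tr([A,B]), where [A,B] = ABA⁻¹B⁻¹, equals −(1/4)·(|ab|² − |a|² − |b|² + |c|² + |d|² − ab·conj(c) − conj(ab)·c − a·conj(b)·d − conj(a)·b·conj(d))² + 2·Re(−a³|b|² + a²·conj(b)²·conj(d) + a²b²c − a|b|²·conj(d)·c − |a|²b³ − |a|²bcd + a²·conj(c)·d + a²·conj(b)·c + a²·conj(d)·b + ab²d − 2abc² + acd² + conj(b)·conj(d)·c² + b²c·conj(a) − 2bd²·conj(a) + c²d·conj(a) + a³ + (3/2)ab·conj(c) + (3/2)a·conj(b)·d − 3ac·conj(d) + b³ + b²·conj(c)·conj(d) − 3bcd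 + c³ + d³ + d²·conj(b)·conj(c)) + (5/2)|ab|² + |cd|² − (9/2)(|a|² + |b|² + |c|² + |d|²) + 27/4. -/
open Matrix

noncomputable def hp (a A b B c C d D : ℂ) : ℂ :=
  (-a ^ 3 * (b * B) + a ^ 2 * B ^ 2 * D + a ^ 2 * b ^ 2 * c
            - a * (b * B) * D * c - (a * A) * b ^ 3 - (a * A) * b * c * d
            + a ^ 2 * C * d + a ^ 2 * B * c + a ^ 2 * D * b + a * b ^ 2 * d
            - 2 * a * b * c ^ 2 + a * c * d ^ 2 + B * D * c ^ 2 + b ^ 2 * c * A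
            - 2 * b * d ^ 2 * A + c ^ 2 * d * A + a ^ 3 + (3 / 2) * a * b * C
            + (3 / 2) * a * B * d - 3 * a * c * D + b ^ 3 + b ^ 2 * C * D
            - 3 * b * c * d + c ^ 3 + d ^ 3 + d ^ 2 * B * C)

noncomputable def kp (a A b B c C d D : ℂ) : ℂ :=
  -(1 / 4) * ((a * b) * (A * B) - a * A - b * B + c * C + d * D
          - a * b * C - (A * B) * c - a * B * d - A * b * D) ^ 2
      + (hp a A b B c C d D + hp A a B b C c D d)
      + (5 / 2) * ((a * b) * (A * B)) + (c * d) * (C * D)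
      - (9 / 2) * (a * A + b * B + c * C + d * D) + 27 / 4

def Phi (A A' B B' : Matrix (Fin 3) (Fin 3) ℂ) : Prop :=
  -(1/4) * ((A * B * A' * B').trace - (B * A * B' * A').trace) ^ 2 =
    kp A.trace A'.trace B.trace B'.trace (A * B).trace (B' * A').trace
      (A' * B).trace (B' * A).trace

set_option maxHeartbeats 4000000 in
theorem key_poly (x y z u v w m n k σ : ℂ) (hxyz : x * y * z = 1)
    (hσ : σ = 1 - u * v * w + u * m + v * n + w * k) :
    -(1/4) * ((x - y) * (y - z) * (z - x)) ^ 2 * (σ ^ 2 - 4 * (m * n * k)) =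
    kp (x + y + z) (y * z + x * z + x * y) (u + v + w) ((v * w - m) + (u * w - n) + (u * v - k))
      (x * u + y * v + z * w)
      (y * z * (v * w - m) + x * z * (u * w - n) + x * y * (u * v - k))
      (y * z * u + x * z * v + x * y * w)
      (x * (v * w - m) + y * (u * w - n) + z * (u * v - k)) := by
  have hx : x ≠ 0 := by rintro rfl; simp at hxyz
  have hy : y ≠ 0 := by rintro rfl; simp at hxyz
  have hz : z = 1 / (x * y) := by field_simp; linear_combination hxyz
  subst hσ hz
  unfold kp hp
  field_simp
  ring

theorem phi_conj (P Q : Matrix (Fin 3) (Fin 3) ℂ) (h : P * Q = 1)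
    (A A' B B' : Matrix (Fin 3) (Fin 3) ℂ)
    (H : Phi (Q * A * P) (Q * A' * P) (Q * B * P) (Q * B' * P)) : Phi A A' B B' := by
  have e : ∀ X Y : Matrix (Fin 3) (Fin 3) ℂ, (Q * X * P) * (Q * Y * P) = Q * (X * Y) * P := by
    intro X Y
    calc _ = Q * X * (P * Q) * Y * P := by simp only [Matrix.mul_assoc]
      _ = _ := by rw [h]; simp only [Matrix.mul_assoc, Matrix.mul_one]
  have t : ∀ X : Matrix (Fin 3) (Fin 3) ℂ, (Q * X * P).trace = X.trace := by
    intro X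
    rw [Matrix.trace_mul_comm, ← Matrix.mul_assoc, h, Matrix.one_mul]
  unfold Phi at *
  simpa only [e, t] using H

theorem phi_diag (x y z : ℂ) (hxyz : x * y * z = 1) (B : Matrix (Fin 3) (Fin 3) ℂ)
    (hB : B.det = 1) :
    Phi !![x,0,0;0,y,0;0,0,z] !![y*z,0,0;0,x*z,0;0,0,x*y] B B.adjugate := by
  have := key_poly x y z (B 0 0) (B 1 1) (B 2 2) (B 1 2 * B 2 1) (B 0 2 * B 2 0) (B 0 1 * B 1 0)
    (B 0 1 * B 1 2 * B 2 0 + B 0 2 * B 2 1 * B 1 0) hxyz (by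
      rw [Matrix.det_fin_three] at hB
      linear_combination hB)
  unfold Phi
  rw [Matrix.adjugate_fin_three]
  convert this using 1
  · simp only [Matrix.trace_fin_three, Matrix.mul_apply, Fin.sum_univ_three]
    simp
    ring
  · congr 1 <;> simp only [Matrix.trace_fin_three, Matrix.mul_apply, Fin.sum_univ_three] <;> simp <;> ring

theorem phi_distinct (x y z p q r : ℂ) (hxyz : x * y * z = 1) (h1 : x ≠ y) (h2 : x ≠ z) (h3 : y ≠ z)
    (B B' : Matrix (Fin 3) (Fin 3) ℂ) (hB : B.det = 1) (hBB : B * B' = 1) :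
    Phi !![x,p,q;0,y,r;0,0,z] !![y*z,-p*z,p*r-q*y;0,x*z,-x*r;0,0,x*y] B B' := by
  set P : Matrix (Fin 3) (Fin 3) ℂ :=
    !![1, p, p*r+q*(z-y); 0, y-x, r*(z-x); 0,0,(z-x)*(z-y)] with hP
  have hd : P.det ≠ 0 := by
    rw [Matrix.det_fin_three]
    simp [hP, sub_eq_zero, h1.symm, h2.symm, h3.symm]
  have hu : IsUnit P.det := isUnit_iff_ne_zero.mpr hd
  have hPQ : P * P⁻¹ = 1 := Matrix.mul_nonsing_inv P hu
  have hQP : P⁻¹ * P = 1 := Matrix.nonsing_inv_mul P hu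
  apply phi_conj P P⁻¹ hPQ
  have e1 : !![x,p,q;0,y,r;0,0,z] * P = P * !![x,0,0;0,y,0;0,0,z] := by
    ext i j; fin_cases i <;> fin_cases j <;>
      simp [hP, Matrix.mul_apply, Fin.sum_univ_three] <;> ring
  have e2 : !![y*z,-p*z,p*r-q*y;0,x*z,-x*r;0,0,x*y] * P = P * !![y*z,0,0;0,x*z,0;0,0,x*y] := by
    ext i j; fin_cases i <;> fin_cases j <;>
      simp [hP, Matrix.mul_apply, Fin.sum_univ_three] <;> ring
  have hdet : (P⁻¹ * B * P).det = 1 := by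
    rw [Matrix.det_mul, Matrix.det_mul, mul_comm, ← mul_assoc, ← Matrix.det_mul, hPQ, hB]; simp
  have e3 : P⁻¹ * B' * P = (P⁻¹ * B * P).adjugate := by
    have a1 : (P⁻¹ * B * P) * (P⁻¹ * B' * P) = 1 := by
      calc _ = P⁻¹ * B * (P * P⁻¹) * B' * P := by simp only [Matrix.mul_assoc]
        _ = P⁻¹ * (B * B') * P := by rw [hPQ]; simp only [Matrix.mul_assoc, Matrix.one_mul]
        _ = 1 := by rw [hBB, Matrix.mul_one, hQP]
    have a2 := Matrix.adjugate_mul (P⁻¹ * B * P)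
    rw [hdet, one_smul] at a2
    calc _ = (P⁻¹ * B * P).adjugate * (P⁻¹ * B * P) * (P⁻¹ * B' * P) := by rw [a2, Matrix.one_mul]
      _ = _ := by rw [Matrix.mul_assoc, a1, Matrix.mul_one]
  rw [Matrix.mul_assoc, e1, ← Matrix.mul_assoc, hQP, Matrix.one_mul, 
    Matrix.mul_assoc, e2, ← Matrix.mul_assoc, hQP, Matrix.one_mul, e3]
  exact phi_diag x y z hxyz _ hdet

theorem ev_ne (x y : ℂ) (hx : x ≠ 0) (k l : ℝ) (hkl : k ≠ l) :
    ∀ᶠ s : ℝ in nhdsWithin 0 {0}ᶜ, x * (Real.exp (k * s) : ℂ) ≠ y * (Real.exp (l * s) : ℂ) := by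
  by_cases h : x = y
  · subst h
    filter_upwards [self_mem_nhdsWithin] with s hs he
    have := mul_left_cancel₀ hx he
    have := Real.exp_injective (Complex.ofReal_injective this)
    exact hkl (mul_right_cancel₀ hs this)
  · apply Filter.Eventually.filter_mono nhdsWithin_le_nhds
    have : ContinuousAt (fun s : ℝ => x * (Real.exp (k * s) : ℂ) - y * (Real.exp (l * s) : ℂ)) 0 := by
      fun_prop
    have := this.eventually_ne (y := 0) (by simpa [sub_eq_zero] using h)
    filter_upwards [this] with s hs
    exact sub_ne_zero.mp hs

theorem phi_tri (x y z p q r : ℂ) (hxyz : x * y * z = 1)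
    (B B' : Matrix (Fin 3) (Fin 3) ℂ) (hB : B.det = 1) (hBB : B * B' = 1) :
    Phi !![x,p,q;0,y,r;0,0,z] !![y*z,-p*z,p*r-q*y;0,x*z,-x*r;0,0,x*y] B B' := by
  have hx : x ≠ 0 := by rintro rfl; simp at hxyz
  have hy : y ≠ 0 := by rintro rfl; simp at hxyz
  let X : ℝ → ℂ := fun s => x * (Real.exp (1 * s) : ℂ)
  let Y : ℝ → ℂ := fun s => y * (Real.exp (2 * s) : ℂ)
  let Z : ℝ → ℂ := fun s => z * (Real.exp (-3 * s) : ℂ)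
  have hX : Continuous X := by fun_prop
  have hY : Continuous Y := by fun_prop
  have hZ : Continuous Z := by fun_prop
  let T : ℝ → Matrix (Fin 3) (Fin 3) ℂ := fun s => !![X s,p,q;0,Y s,r;0,0,Z s]
  let T' : ℝ → Matrix (Fin 3) (Fin 3) ℂ := fun s => !![Y s*Z s,-p*Z s,p*r-q*Y s;0,X s*Z s,-X s*r;0,0,X s*Y s]
  have hT : Continuous T := by
    refine continuous_matrix fun i j => ?_
    fin_cases i <;> fin_cases j <;> simp [T] <;> fun_prop
  have hT' : Continuous T' := by
    refine continuous_matrix fun i j => ?_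
    fin_cases i <;> fin_cases j <;> simp [T'] <;> fun_prop
  let f : ℝ → ℂ := fun s => -(1/4) * ((T s * B * T' s * B').trace - (B * T s * B' * T' s).trace) ^ 2 -
    kp (T s).trace (T' s).trace B.trace B'.trace (T s * B).trace (B' * T' s).trace
      (T' s * B).trace (B' * T s).trace
  have hf : Continuous f := by
    have tc : ∀ g : ℝ → Matrix (Fin 3) (Fin 3) ℂ, Continuous g → Continuous fun s => (g s).trace :=
      fun g hg => hg.matrix_trace
    have c1 := tc _ (((hT.matrix_mul (continuous_const (y := B))).matrix_mul hT').matrix_mul (continuous_const (y := B')))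
    have c2 := tc _ ((((continuous_const (y := B)).matrix_mul hT).matrix_mul (continuous_const (y := B'))).matrix_mul hT')
    have c3 := tc _ hT
    have c4 := tc _ hT'
    have c5 := tc _ (hT.matrix_mul (continuous_const (y := B)))
    have c6 := tc _ ((continuous_const (y := B')).matrix_mul hT')
    have c7 := tc _ (hT'.matrix_mul (continuous_const (y := B)))
    have c8 := tc _ ((continuous_const (y := B')).matrix_mul hT)
    unfold f kp hp
    fun_prop
  have hev : ∀ᶠ s in nhdsWithin (0:ℝ) {0}ᶜ, f s = 0 := by
    filter_upwards [ev_ne x y hx 1 2 (by norm_num), ev_ne x z hx 1 (-3) (by norm_num),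
      ev_ne y z hy 2 (-3) (by norm_num)] with s h1 h2 h3
    have := phi_distinct (X s) (Y s) (Z s) p q r (by
      have : Real.exp (1 * s) * Real.exp (2 * s) * Real.exp (-3 * s) = 1 := by
        rw [← Real.exp_add, ← Real.exp_add]; ring_nf; simp
      have : (Real.exp (1 * s) : ℂ) * (Real.exp (2 * s) : ℂ) * (Real.exp (-3 * s) : ℂ) = 1 := by
        exact_mod_cast this
      simp only [X, Y, Z]
      linear_combination (x * y * z) * this + hxyz) h1 h2 h3 B B' hB hBB
    exact sub_eq_zero.mpr this
  have h0 : f 0 = 0 := by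
    have l1 : Filter.Tendsto f (nhdsWithin (0:ℝ) {0}ᶜ) (nhds (f 0)) :=
      (hf.tendsto 0).mono_left nhdsWithin_le_nhds
    have l2 : Filter.Tendsto f (nhdsWithin (0:ℝ) {0}ᶜ) (nhds 0) :=
      tendsto_const_nhds.congr' (by filter_upwards [hev] with s hs; exact hs.symm)
    exact tendsto_nhds_unique l1 l2
  have := sub_eq_zero.mp h0
  simpa [T, T', X, Y, Z, Phi] using this

theorem step (n : ℕ) (A : Matrix (Fin (n+1)) (Fin (n+1)) ℂ) :
    ∃ P Q : Matrix (Fin (n+1)) (Fin (n+1)) ℂ, P * Q = 1 ∧ Q * P = 1 ∧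
      ∀ i, i ≠ 0 → (Q * A * P) i 0 = 0 := by
  obtain ⟨μ, hμ⟩ := Module.End.exists_eigenvalue (Matrix.toLin' A)
  obtain ⟨v, hv⟩ := hμ.exists_hasEigenvector
  have hv1 := hv.apply_eq_smul
  have hv0 := hv.2
  obtain ⟨e, he⟩ := SeparatingDual.exists_continuousLinearEquiv_apply_eq (R := ℂ)
    (x := (Pi.single 0 1 : Fin (n+1) → ℂ)) (y := v) (by simp) hv0
  refine ⟨LinearMap.toMatrix' (e : (Fin (n+1) → ℂ) →ₗ[ℂ] (Fin (n+1) → ℂ)),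
    LinearMap.toMatrix' (e.symm : (Fin (n+1) → ℂ) →ₗ[ℂ] (Fin (n+1) → ℂ)), ?_, ?_, ?_⟩
  · rw [← LinearMap.toMatrix'_comp, ← LinearMap.toMatrix'_id]; congr 1; ext; simp
  · rw [← LinearMap.toMatrix'_comp, ← LinearMap.toMatrix'_id]; congr 1; ext; simp
  · intro i hi
    have hA : A = LinearMap.toMatrix' (Matrix.toLin' A) := by simp
    rw [hA, ← LinearMap.toMatrix'_comp, ← LinearMap.toMatrix'_comp, LinearMap.toMatrix'_apply]
    have : (Pi.single 0 1 : Fin (n+1) → ℂ) = e.symm v := by rw [← he]; simp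
    have h2 : e.symm (Matrix.toLin' A (e (Pi.single 0 1))) = μ • Pi.single 0 1 := by
      rw [he, hv1, map_smul, ← this]
    have h3 := congrFun h2 i
    simpa [hi, Pi.single_apply, Function.comp] using h3

theorem phi_all (A A' B B' : Matrix (Fin 3) (Fin 3) ℂ) (hA : A.det = 1) (hAA : A * A' = 1)
    (hB : B.det = 1) (hBB : B * B' = 1) : Phi A A' B B' := by
  obtain ⟨P, Q, hPQ, hQP, h0⟩ :=
    (show ∃ P Q : Matrix (Fin 3) (Fin 3) ℂ, P * Q = 1 ∧ Q * P = 1 ∧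
      ∀ i : Fin 3, i ≠ 0 → (Q * A * P) i 0 = 0 from step 2 A)
  set A1 := Q * A * P with hA1
  obtain ⟨R, S, hRS, hSR, h1⟩ :=
    (show ∃ P Q : Matrix (Fin 2) (Fin 2) ℂ, P * Q = 1 ∧ Q * P = 1 ∧
      ∀ i : Fin 2, i ≠ 0 → (Q * !![A1 1 1, A1 1 2; A1 2 1, A1 2 2] * P) i 0 = 0 from step 1 !![A1 1 1, A1 1 2; A1 2 1, A1 2 2])
  have h1' := h1 1 (by simp)
  let R' : Matrix (Fin 3) (Fin 3) ℂ := !![1,0,0;0,R 0 0,R 0 1;0,R 1 0,R 1 1]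
  let S' : Matrix (Fin 3) (Fin 3) ℂ := !![1,0,0;0,S 0 0,S 0 1;0,S 1 0,S 1 1]
  have hRS' : R' * S' = 1 := by
    have q := fun i j => congrFun (congrFun hRS i) j
    have q1 := q 0 0
    have q2 := q 0 1
    have q3 := q 1 0
    have q4 := q 1 1
    simp [Matrix.mul_apply, Fin.sum_univ_two] at q1 q2 q3 q4
    ext i j; fin_cases i <;> fin_cases j <;>
      simp [R', S', Matrix.mul_apply, Fin.sum_univ_three, q1, q2, q3, q4]
  have hU : (P * R') * (S' * Q) = 1 := by
    calc _ = P * (R' * S') * Q := by simp only [Matrix.mul_assoc]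
      _ = 1 := by rw [hRS', Matrix.mul_one, hPQ]
  have hU' : (S' * Q) * (P * R') = 1 := mul_eq_one_comm.mp hU
  apply phi_conj (P * R') (S' * Q) hU
  set T := S' * Q * A * (P * R') with hT
  have hTA : T = S' * A1 * R' := by simp only [hT, hA1, Matrix.mul_assoc]
  have g1 := h0 1 (by simp)
  have g2 := h0 2 (by simp)
  have t10 : T 1 0 = 0 := by
    rw [hTA]; simp only [Matrix.mul_apply, Fin.sum_univ_three]; simp [S', R', g1, g2]
  have t20 : T 2 0 = 0 := by
    rw [hTA]; simp only [Matrix.mul_apply, Fin.sum_univ_three]; simp [S', R', g1, g2]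
  have t21 : T 2 1 = 0 := by
    rw [hTA, ← h1']; simp only [Matrix.mul_apply, Fin.sum_univ_three, Fin.sum_univ_two]; simp [S', R']
  have hc : ∀ X Y : Matrix (Fin 3) (Fin 3) ℂ, X * Y = 1 →
      (S' * Q * X * (P * R')) * (S' * Q * Y * (P * R')) = 1 := by
    intro X Y h
    calc _ = (S' * Q) * X * ((P * R') * (S' * Q)) * Y * (P * R') := by simp only [Matrix.mul_assoc]
      _ = (S' * Q) * (X * Y) * (P * R') := by rw [hU]; simp only [Matrix.mul_assoc, Matrix.one_mul]
      _ = 1 := by rw [h, Matrix.mul_one, hU']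
  have hdet : ∀ X : Matrix (Fin 3) (Fin 3) ℂ, X.det = 1 → (S' * Q * X * (P * R')).det = 1 := by
    intro X h
    rw [Matrix.det_mul, Matrix.det_mul, mul_comm, ← mul_assoc, ← Matrix.det_mul, hU, h]; simp
  have hTd : T.det = 1 := hdet A hA
  have hTd2 : T 0 0 * T 1 1 * T 2 2 = 1 := by
    rw [Matrix.det_fin_three, t10, t20, t21] at hTd
    linear_combination hTd
  have hTe : T = !![T 0 0, T 0 1, T 0 2; 0, T 1 1, T 1 2; 0, 0, T 2 2] := by
    ext i j; fin_cases i <;> fin_cases j <;> simp [t10, t20, t21]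
  have hTi : S' * Q * A' * (P * R') = T.adjugate := by
    have a1 := hc A A' hAA
    rw [← hT] at a1
    have a2 := Matrix.adjugate_mul T
    rw [hTd, one_smul] at a2
    calc _ = T.adjugate * T * (S' * Q * A' * (P * R')) := by rw [a2, Matrix.one_mul]
      _ = _ := by rw [Matrix.mul_assoc, a1, Matrix.mul_one]
  have key := phi_tri (T 0 0) (T 1 1) (T 2 2) (T 0 1) (T 0 2) (T 1 2) hTd2 _ _ (hdet B hB) (hc B B' hBB)
  rw [← hTe] at key
  rw [hTi]
  convert key using 1
  rw [Matrix.adjugate_fin_three]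
  ext i j; fin_cases i <;> fin_cases j <;> simp [t10, t20, t21] <;> ring

theorem formJ_sq : formJ * formJ = 1 := by
  unfold formJ
  rw [Matrix.diagonal_mul_diagonal, ← Matrix.diagonal_one]
  congr 1; ext i; fin_cases i <;> simp

theorem inv_of_form (M : Matrix (Fin 3) (Fin 3) ℂ) (h : Mᴴ * formJ * M = formJ) :
    M⁻¹ = formJ * Mᴴ * formJ := by
  apply Matrix.inv_eq_left_inv
  rw [Matrix.mul_assoc, Matrix.mul_assoc, ← Matrix.mul_assoc Mᴴ, h, formJ_sq]

theorem star_trace_of_form (M : Matrix (Fin 3) (Fin 3) ℂ) (h : Mᴴ * formJ * M = formJ) :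
    star M.trace = M⁻¹.trace := by
  rw [inv_of_form M h, Matrix.trace_mul_comm, ← Matrix.mul_assoc, formJ_sq, Matrix.one_mul,
    Matrix.trace_conjTranspose]

theorem form_mul (M N : Matrix (Fin 3) (Fin 3) ℂ) (h : Mᴴ * formJ * M = formJ)
    (h' : Nᴴ * formJ * N = formJ) : (M * N)ᴴ * formJ * (M * N) = formJ := by
  calc _ = Nᴴ * (Mᴴ * formJ * M) * N := by
        simp only [Matrix.conjTranspose_mul, Matrix.mul_assoc]
    _ = _ := by rw [h, h']

theorem form_inv (M : Matrix (Fin 3) (Fin 3) ℂ) (hd : M * M⁻¹ = 1) (h : Mᴴ * formJ * M = formJ) :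
    (M⁻¹)ᴴ * formJ * M⁻¹ = formJ := by
  calc _ = (M⁻¹)ᴴ * (Mᴴ * formJ * M) * M⁻¹ := by rw [h]
    _ = (M * M⁻¹)ᴴ * formJ * (M * M⁻¹) := by
        simp only [Matrix.conjTranspose_mul, Matrix.mul_assoc]
    _ = formJ := by rw [hd]; simp

theorem su21_im_trace_commutator_sq (A B : Matrix (Fin 3) (Fin 3) ℂ)
    (hA : SU21 A) (hB : SU21 B) (a b c d : ℂ)
    (ha : a = A.trace) (hb : b = B.trace) (hc : c = (A * B).trace)
    (hd : d = (A⁻¹ * B).trace) :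
    ((((A * B * A⁻¹ * B⁻¹).trace).im : ℂ)) ^ 2 =
      -(1 / 4) * ((a * b) * star (a * b) - a * star a - b * star b + c * star c + d * star d
          - a * b * star c - star (a * b) * c - a * star b * d - star a * b * star d) ^ 2
      + (((-a ^ 3 * (b * star b) + a ^ 2 * (star b) ^ 2 * star d + a ^ 2 * b ^ 2 * c
            - a * (b * star b) * star d * c - (a * star a) * b ^ 3 - (a * star a) * b * c * d
            + a ^ 2 * star c * d + a ^ 2 * star b * c + a ^ 2 * star d * b + a * b ^ 2 * d
            - 2 * a * b * c ^ 2 + a * c * d ^ 2 + star b * star d * c ^ 2 + b ^ 2 * c * star a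
            - 2 * b * d ^ 2 * star a + c ^ 2 * d * star a + a ^ 3 + (3 / 2) * a * b * star c
            + (3 / 2) * a * star b * d - 3 * a * c * star d + b ^ 3 + b ^ 2 * star c * star d
            - 3 * b * c * d + c ^ 3 + d ^ 3 + d ^ 2 * star b * star c))
        + star ((-a ^ 3 * (b * star b) + a ^ 2 * (star b) ^ 2 * star d + a ^ 2 * b ^ 2 * c
            - a * (b * star b) * star d * c - (a * star a) * b ^ 3 - (a * star a) * b * c * d
            + a ^ 2 * star c * d + a ^ 2 * star b * c + a ^ 2 * star d * b + a * b ^ 2 * d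
            - 2 * a * b * c ^ 2 + a * c * d ^ 2 + star b * star d * c ^ 2 + b ^ 2 * c * star a
            - 2 * b * d ^ 2 * star a + c ^ 2 * d * star a + a ^ 3 + (3 / 2) * a * b * star c
            + (3 / 2) * a * star b * d - 3 * a * c * star d + b ^ 3 + b ^ 2 * star c * star d
            - 3 * b * c * d + c ^ 3 + d ^ 3 + d ^ 2 * star b * star c)))
      + (5 / 2) * ((a * b) * star (a * b)) + (c * d) * star (c * d)
      - (9 / 2) * (a * star a + b * star b + c * star c + d * star d) + 27 / 4 := by
  obtain ⟨dA, fA⟩ := hA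
  obtain ⟨dB, fB⟩ := hB
  have uA : IsUnit A.det := by rw [dA]; exact isUnit_one
  have uB : IsUnit B.det := by rw [dB]; exact isUnit_one
  have iA : A * A⁻¹ = 1 := Matrix.mul_nonsing_inv A uA
  have iB : B * B⁻¹ = 1 := Matrix.mul_nonsing_inv B uB
  have fA' := form_inv A iA fA
  have fB' := form_inv B iB fB
  have iiA : A⁻¹⁻¹ = A := Matrix.nonsing_inv_nonsing_inv A uA
  have iiB : B⁻¹⁻¹ = B := Matrix.nonsing_inv_nonsing_inv B uB
  have sa : star a = A⁻¹.trace := by rw [ha, star_trace_of_form A fA]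
  have sb : star b = B⁻¹.trace := by rw [hb, star_trace_of_form B fB]
  have sc : star c = (B⁻¹ * A⁻¹).trace := by
    rw [hc, star_trace_of_form _ (form_mul A B fA fB), Matrix.mul_inv_rev]
  have sd : star d = (B⁻¹ * A).trace := by
    rw [hd, star_trace_of_form _ (form_mul _ B fA' fB), Matrix.mul_inv_rev, iiA]
  have stt : star ((A * B * A⁻¹ * B⁻¹).trace) = (B * A * B⁻¹ * A⁻¹).trace := by
    rw [star_trace_of_form _ (form_mul _ _ (form_mul _ _ (form_mul A B fA fB) fA') fB')]
    simp only [Matrix.mul_inv_rev, iiA, iiB, Matrix.mul_assoc]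
  have key := phi_all A A⁻¹ B B⁻¹ dA iA dB iB
  unfold Phi at key
  rw [← stt, ← sa, ← sb, ← sc, ← sd, ← ha, ← hb, ← hc, ← hd] at key
  have him : ∀ w : ℂ, ((w.im : ℂ)) ^ 2 = -(1/4) * (w - star w) ^ 2 := by
    intro w
    have h2 : w - star w = 2 * (w.im : ℂ) * Complex.I := by
      have := Complex.sub_conj w
      rw [← starRingEnd_apply, this]; push_cast; ring
    rw [h2, mul_pow, Complex.I_sq]; ring
  rw [him, key]
  unfold kp hp
  have s2 : star (2:ℂ) = 2 := by simp
  have s3 : star (3:ℂ) = 3 := by simp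
  have s32 : star (3 / 2:ℂ) = 3 / 2 := by simp
  simp only [star_add, star_sub, star_mul', star_neg, star_pow, star_star, s2, s3, s32]
end

section
/- Let p, q, r be pairwise coprime positive integers and a, b, c integers with a/p + b/q + c/r = 1/(pqr), and let π be the group presented by generators x, y, z, h and relations saying that h commutes with x, y, z and that x^p h^a = y^q h^b = z^r h^c = xyz = 1 (the fundamental group of the Brieskorn homology sphere Σ(p,q,r)). Let ρ and ρ' be irreducible representations of π into SU(2,1). Then ρ and ρ' are conjugate by an element of SU(2,1) if and only if: ρ(x) is conjugate in SU(2,1) to ρ'(x), ρ(y) is conjugate in SU(2,1) to ρ'(y), ρ(h) is conjugate in SU(2,1) to ρ'(h), tr ρ(xy) = tr ρ'(xy), tr ρ(x⁻¹y) = tr ρ'(x⁻¹y), and Im(tr ρ([x,y])) = Im(tr ρ'([x,y])), where [x,y] = xyx⁻¹y⁻¹. -/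
open Matrix

/-- The relations of the standard presentation of the fundamental group of the
Brieskorn homology sphere `Σ(p,q,r)`, on generators `x = 0`, `y = 1`, `z = 2`, `h = 3`:
`h` is central and `x^p h^a = y^q h^b = z^r h^c = xyz = 1`. -/
def brieskornRels (p q r : ℕ) (a b c : ℤ) : Set (FreeGroup (Fin 4)) :=
  {FreeGroup.of 3 * FreeGroup.of 0 * (FreeGroup.of 3)⁻¹ * (FreeGroup.of 0)⁻¹,
   FreeGroup.of 3 * FreeGroup.of 1 * (FreeGroup.of 3)⁻¹ * (FreeGroup.of 1)⁻¹,
   FreeGroup.of 3 * FreeGroup.of 2 * (FreeGroup.of 3)⁻¹ * (FreeGroup.of 2)⁻¹,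
   FreeGroup.of 0 ^ (p : ℤ) * FreeGroup.of 3 ^ a,
   FreeGroup.of 1 ^ (q : ℤ) * FreeGroup.of 3 ^ b,
   FreeGroup.of 2 ^ (r : ℤ) * FreeGroup.of 3 ^ c,
   FreeGroup.of 0 * FreeGroup.of 1 * FreeGroup.of 2}

/-- The fundamental group of the Brieskorn homology sphere `Σ(p,q,r)`. -/
def BrieskornGroup (p q r : ℕ) (a b c : ℤ) : Type :=
  PresentedGroup (brieskornRels p q r a b c)

instance (p q r : ℕ) (a b c : ℤ) : Group (BrieskornGroup p q r a b c) :=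
  inferInstanceAs (Group (PresentedGroup (brieskornRels p q r a b c)))

/-- The generator `x` of the Brieskorn group. -/
def bX (p q r : ℕ) (a b c : ℤ) : BrieskornGroup p q r a b c := PresentedGroup.of 0

/-- The generator `y` of the Brieskorn group. -/
def bY (p q r : ℕ) (a b c : ℤ) : BrieskornGroup p q r a b c := PresentedGroup.of 1

/-- The generator `h` of the Brieskorn group. -/
def bH (p q r : ℕ) (a b c : ℤ) : BrieskornGroup p q r a b c := PresentedGroup.of 3

/-- A representation `ρ : G → GL(3,ℂ)` is irreducible if the only invariant subspaces
of `ℂ³` are `0` and `ℂ³`. -/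
def IsIrreducibleRep {G : Type*} [Group G] (ρ : G →* GL (Fin 3) ℂ) : Prop :=
  ∀ W : Submodule ℂ (Fin 3 → ℂ),
    (∀ g : G, ∀ v ∈ W, (ρ g : Matrix (Fin 3) (Fin 3) ℂ).mulVec v ∈ W) → W = ⊥ ∨ W = ⊤

/-- Two elements of `GL(3,ℂ)` are conjugate by an element of SU(2,1). -/
def ConjInSU21 (A B : GL (Fin 3) ℂ) : Prop :=
  ∃ P : GL (Fin 3) ℂ, SU21 (P : Matrix (Fin 3) (Fin 3) ℂ) ∧ B = P * A * P⁻¹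


theorem M3.inv_eq_adj {X Y : M3} (hd : X.det = 1) (h : X * Y = 1) : Y = X.adjugate := by
  have : X.adjugate * X = 1 := by rw [Matrix.adjugate_mul, hd, one_smul]
  calc Y = (X.adjugate * X) * Y := by rw [this, one_mul]
    _ = _ := by rw [mul_assoc, h, mul_one]

theorem M3.xux {X Y : M3} (U : M3) (hd : X.det = 1) (h : X * Y = 1) :
    X * U * X = Y.trace • U - Y * U - U * Y + U.trace • Y + (X * U).trace • X
      + ((Y * U).trace - U.trace * Y.trace) • (1 : M3) := by
  rw [M3.inv_eq_adj hd h]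
  ext i j
  fin_cases i <;> fin_cases j <;>
  simp only [Matrix.add_apply, Matrix.sub_apply, Matrix.smul_apply, Matrix.mul_apply,
    Fin.sum_univ_three, Matrix.trace_fin_three, Matrix.adjugate_fin_three] <;>
  simp <;> ring

theorem M3.pol (X Y Z : M3) :
    X * Y * Z + X * Z * Y + Y * X * Z + Y * Z * X + Z * X * Y + Z * Y * X =
      X.trace • (Y * Z + Z * Y) + Y.trace • (X * Z + Z * X) + Z.trace • (X * Y + Y * X)
      + ((X * Y).trace - X.trace * Y.trace) • Z
      + ((X * Z).trace - X.trace * Z.trace) • Y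
      + ((Y * Z).trace - Y.trace * Z.trace) • X
      + (X.trace * Y.trace * Z.trace - (X * Y).trace * Z.trace - (X * Z).trace * Y.trace
        - (Y * Z).trace * X.trace + (X * Y * Z).trace + (X * Z * Y).trace) • (1 : M3) := by
  ext i j
  fin_cases i <;> fin_cases j <;>
  simp [Matrix.trace_fin_three, Matrix.mul_apply, Fin.sum_univ_three] <;> ring

theorem M3.comm_sum {A B A' B' : M3} (hA : A * A' = 1) (hB : B * B' = 1) :
    (A * B * A' * B').trace + (B * A * B' * A').trace =
      4 * A.trace * A'.trace + 2 * B.trace * B'.trace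
      + ((A * B).trace - A.trace * B.trace) * (A' * B').trace
      + (3 - A.trace * A'.trace) * 3
      + ((B * A').trace - B.trace * A'.trace) * (A * B').trace
      + (A.trace * B.trace * A'.trace - (A * B).trace * A'.trace - B.trace
        - (B * A').trace * A.trace) * B'.trace - 12 := by
  have hA2 : A' * A = 1 := mul_eq_one_comm.1 hA
  have hB2 : B' * B = 1 := mul_eq_one_comm.1 hB
  have h := congrArg (fun m => (m * B').trace) (M3.pol A B A')
  have e2 : B * A * A' * B' = 1 := by rw [mul_assoc B, hA, mul_one, hB]
  have e3 : B * A' * A * B' = 1 := by rw [mul_assoc B, hA2, mul_one, hB]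
  have e5 : (A' * B * A * B').trace = (B * A * B' * A').trace := by
    rw [show A' * B * A * B' = A' * (B * A * B') by simp only [mul_assoc], Matrix.trace_mul_comm]
  have e6 : (B * A' * B').trace = A'.trace := by
    rw [Matrix.trace_mul_comm, ← mul_assoc, hB2, one_mul]
  have e7 : (B * A * B').trace = A.trace := by
    rw [Matrix.trace_mul_comm, ← mul_assoc, hB2, one_mul]
  have e8 : A' * B * B' = A' := by rw [mul_assoc, hB, mul_one]
  have e9 : A * B * B' = A := by rw [mul_assoc, hB, mul_one]
  have e10 : (A * B * A').trace = B.trace := by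
    rw [Matrix.trace_mul_comm, ← mul_assoc, hA2, one_mul]
  simp only [add_mul, Matrix.trace_add, smul_mul_assoc, Matrix.trace_smul, smul_eq_mul, e2, e3, e5,
    e6, e7, e8, e9, e10, hA, hA2, hB, one_mul, Matrix.trace_one, Fintype.card_fin] at h
  push_cast at h
  linear_combination h

/-- pairs of matrices with equal traces -/
def eqTr : Submodule ℂ (M3 × M3) where
  carrier := {r | r.1.trace = r.2.trace}
  add_mem' := by
    intro a b ha hb
    simp only [Set.mem_ofPred_eq] at ha hb
    simp [ha, hb]
  zero_mem' := by simp
  smul_mem' := by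
    intro c a ha
    simp only [Set.mem_ofPred_eq] at ha
    simp [ha]

theorem mem_eqTr {r : M3 × M3} : r ∈ eqTr ↔ r.1.trace = r.2.trace := Iff.rfl

theorem eqTr_comm {r s : M3 × M3} (h : r * s ∈ eqTr) : s * r ∈ eqTr := by
  rw [mem_eqTr] at h ⊢
  simp only [Prod.fst_mul, Prod.snd_mul] at h ⊢
  rw [Matrix.trace_mul_comm, h, Matrix.trace_mul_comm]

theorem pair_xux {x y u : M3 × M3} (hd1 : x.1.det = 1) (hd2 : x.2.det = 1) (h : x * y = 1)
    (hy : y ∈ eqTr) (hu : u ∈ eqTr) (hxu : x * u ∈ eqTr) (hyu : y * u ∈ eqTr)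
    (K : Submodule ℂ (M3 × M3)) (k1 : 1 ∈ K) (kx : x ∈ K) (ky : y ∈ K) (ku : u ∈ K)
    (kyu : y * u ∈ K) (kuy : u * y ∈ K) : x * u * x ∈ K := by
  have h1 : x.1 * y.1 = 1 := congrArg Prod.fst h
  have h2 : x.2 * y.2 = 1 := congrArg Prod.snd h
  rw [mem_eqTr] at hy hu hxu hyu
  simp only [Prod.fst_mul, Prod.snd_mul] at hxu hyu
  have key : x * u * x = y.1.trace • u - y * u - u * y + u.1.trace • y + (x.1 * u.1).trace • x
      + ((y.1 * u.1).trace - u.1.trace * y.1.trace) • (1 : M3 × M3) := by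
    apply Prod.ext
    · simpa using M3.xux u.1 hd1 h1
    · rw [hy, hu, hxu, hyu]
      simpa using M3.xux u.2 hd2 h2
  rw [key]
  exact K.add_mem (K.add_mem (K.add_mem (K.sub_mem (K.sub_mem (K.smul_mem _ ku) kyu) kuy)
    (K.smul_mem _ ky)) (K.smul_mem _ kx)) (K.smul_mem _ k1)

section words

variable (l : Bool × Bool → M3 × M3)

def optL : Option (Bool × Bool) → M3 × M3
  | none => 1
  | some a => l a

def Wsp : Submodule ℂ (M3 × M3) := Submodule.span ℂ (Set.range (optL l))

theorem one_mem_W : (1 : M3 × M3) ∈ Wsp l := Submodule.subset_span ⟨none, rfl⟩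
theorem l_mem_W (a) : l a ∈ Wsp l := Submodule.subset_span ⟨some a, rfl⟩

theorem W_mul {n m : ℕ} {x y : M3 × M3} (hx : x ∈ Wsp l ^ n) (hy : y ∈ Wsp l ^ m) :
    x * y ∈ Wsp l ^ (n + m) := by
  rw [pow_add]; exact Submodule.mul_mem_mul hx hy

theorem W_mono {n m : ℕ} (h : n ≤ m) : Wsp l ^ n ≤ Wsp l ^ m := by
  induction m, h using Nat.le_induction with
  | base => exact le_rfl
  | succ m _ ih =>
    refine ih.trans ?_
    intro x hx
    rw [pow_succ]
    simpa using Submodule.mul_mem_mul hx (one_mem_W l)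

theorem l_mem_W1 (a) : l a ∈ Wsp l ^ 1 := by rw [pow_one]; exact l_mem_W l a

theorem one_mem_Wn (n) : (1 : M3 × M3) ∈ Wsp l ^ n :=
  W_mono l (Nat.zero_le n) (by rw [pow_zero]; exact Submodule.one_le.1 le_rfl)

theorem W_list (w : List (Bool × Bool)) : (w.map l).prod ∈ Wsp l ^ w.length := by
  induction w with
  | nil => simp
  | cons a w ih =>
    rw [List.map_cons, List.prod_cons, List.length_cons, add_comm]
    exact W_mul l (l_mem_W1 l a) ih

theorem W_le_span (n : ℕ) :
    Wsp l ^ n ≤ Submodule.span ℂ {x | ∃ w : List (Bool × Bool), w.length ≤ n ∧ (w.map l).prod = x} := by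
  induction n with
  | zero =>
    rw [pow_zero, Submodule.one_le]
    exact Submodule.subset_span ⟨[], by simp⟩
  | succ n ih =>
    rw [pow_succ]
    refine (mul_le_mul' ih le_rfl).trans ?_
    rw [Wsp, Submodule.span_mul_span, Submodule.span_le]
    rintro _ ⟨_, ⟨w, hw, rfl⟩, _, ⟨o, rfl⟩, rfl⟩
    apply Submodule.subset_span
    cases o with
    | none => exact ⟨w, by omega, by simp [optL]⟩
    | some a => exact ⟨w ++ [a], by simpa using hw, by simp [optL]⟩

theorem W_succ_le {n : ℕ} {K : Submodule ℂ (M3 × M3)} (hK : Wsp l ^ n ≤ K)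
    (h : ∀ w : List (Bool × Bool), w.length = n + 1 → (w.map l).prod ∈ K) :
    Wsp l ^ (n + 1) ≤ K := by
  refine (W_le_span l (n + 1)).trans (Submodule.span_le.2 ?_)
  rintro _ ⟨w, hw, rfl⟩
  rcases Nat.lt_or_ge n w.length with h1 | h1
  · exact h w (by omega)
  · exact hK (W_mono l h1 (W_list l w))

variable (hinv : ∀ i s, l (i, s) * l (i, !s) = 1)
  (hd1 : ∀ a, (l a).1.det = 1) (hd2 : ∀ a, (l a).2.det = 1)
  (t1 : ∀ a, l a ∈ eqTr)
  (t2 : ∀ s t, l (false, s) * l (true, t) ∈ eqTr)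
  (t4 : ∀ s t, l (false, s) * l (true, t) * l (false, !s) * l (true, !t) ∈ eqTr)

include t1 in
theorem W1_le : Wsp l ^ 1 ≤ eqTr := by
  rw [pow_one, Wsp, Submodule.span_le]
  rintro _ ⟨o, rfl⟩
  cases o with
  | none => simp [optL, mem_eqTr]
  | some a => exact t1 a

include hinv hd1 hd2 t1 in
theorem same_mem (i s s') : l (i, s) * l (i, s') ∈ Wsp l ^ 1 := by
  have h1 := one_mem_Wn l 1
  have e : (1 : M3 × M3) ∈ eqTr := W1_le l t1 h1
  by_cases h : s' = s
  · subst h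
    have := pair_xux (u := 1) (hd1 (i, s')) (hd2 (i, s')) (hinv i s') (t1 _) e (by simpa using t1 _)
      (by simpa using t1 _) (Wsp l ^ 1) h1 (l_mem_W1 l _) (l_mem_W1 l _) h1
      (by simpa using l_mem_W1 l _) (by simpa using l_mem_W1 l _)
    simpa using this
  · have : s' = !s := by cases s <;> cases s' <;> simp_all
    rw [this, hinv]
    exact h1

include hinv hd1 hd2 t1 t2 in
theorem W2_le : Wsp l ^ 2 ≤ eqTr := by
  apply W_succ_le l (W1_le l t1)
  intro w hw
  obtain ⟨⟨i, s⟩, ⟨j, t⟩, rfl⟩ := List.length_eq_two.1 hw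
  simp only [List.map_cons, List.map_nil, List.prod_cons, List.prod_nil, mul_one]
  have := fun i s s' => W1_le l t1 (same_mem l hinv hd1 hd2 t1 i s s')
  cases i <;> cases j
  · exact this _ _ _
  · exact t2 _ _
  · exact eqTr_comm (t2 _ _)
  · exact this _ _ _

include hinv hd1 hd2 t1 t2 in
theorem xux_mem (a b) : l a * l b * l a ∈ Wsp l ^ 2 := by
  have W2 := W2_le l hinv hd1 hd2 t1 t2
  have hl := l_mem_W1 l
  have hl2 : ∀ a, l a ∈ Wsp l ^ 2 := fun a => W_mono l (by norm_num) (hl a)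
  have hm : ∀ a b, l a * l b ∈ Wsp l ^ 2 := fun a b => W_mul l (hl a) (hl b)
  exact pair_xux (hd1 _) (hd2 _) (hinv a.1 a.2) (t1 _) (t1 _) (W2 (hm _ _)) (W2 (hm _ _)) _
    (one_mem_Wn l 2) (hl2 _) (hl2 _) (hl2 _) (hm _ _) (hm _ _)

include hinv hd1 hd2 t1 t2 in
theorem W3_le : Wsp l ^ 3 ≤ eqTr := by
  have W2 := W2_le l hinv hd1 hd2 t1 t2
  apply W_succ_le l W2
  intro w hw
  obtain ⟨⟨i, s⟩, ⟨j, t⟩, ⟨k, u⟩, rfl⟩ := List.length_eq_three.1 hw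
  simp only [List.map_cons, List.map_nil, List.prod_cons, List.prod_nil, mul_one]
  have sm := same_mem l hinv hd1 hd2 t1
  by_cases h1 : j = i
  · subst h1
    rw [← mul_assoc]
    exact W2 (W_mul l (sm _ _ _) (l_mem_W1 l _))
  by_cases h2 : k = j
  · subst h2
    exact W2 (W_mul l (l_mem_W1 l _) (sm _ _ _))
  have h3 : k = i := by cases i <;> cases j <;> cases k <;> simp_all
  subst h3
  rw [← mul_assoc]
  apply eqTr_comm
  rw [← mul_assoc]
  exact W2 (W_mul l (sm _ _ _) (l_mem_W1 l _))

include hinv hd1 hd2 t1 t2 t4 in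
theorem W4_le : Wsp l ^ 4 ≤ eqTr := by
  have W3 := W3_le l hinv hd1 hd2 t1 t2
  apply W_succ_le l W3
  intro w hw
  match w, hw with
  | [(i, s), (j, t), (k, u), (m, v)], _ =>
  simp only [List.map_cons, List.map_nil, List.prod_cons, List.prod_nil, mul_one]
  have sm := same_mem l hinv hd1 hd2 t1
  have xm := xux_mem l hinv hd1 hd2 t1 t2
  have hl := l_mem_W1 l
  by_cases h1 : j = i
  · subst h1
    rw [← mul_assoc]
    exact W3 (W_mul l (sm _ _ _) (W_mul l (hl _) (hl _)))
  by_cases h2 : k = j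
  · subst h2
    rw [← mul_assoc (l (k, t))]
    exact W3 (W_mul l (hl _) (W_mul l (sm _ _ _) (hl _)))
  have h3 : k = i := by cases i <;> cases j <;> cases k <;> simp_all
  subst h3
  by_cases h4 : m = k
  · subst h4
    rw [← mul_assoc, ← mul_assoc]
    apply eqTr_comm
    rw [← mul_assoc, ← mul_assoc, mul_assoc]
    exact W3 (W_mul l (sm _ _ _) (W_mul l (hl _) (hl _)))
  have h5 : m = j := by cases m <;> cases j <;> cases k <;> simp_all
  subst h5
  by_cases h6 : u = s
  · subst h6
    rw [← mul_assoc, ← mul_assoc]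
    exact W3 (W_mul l (xm _ _) (hl _))
  by_cases h7 : v = t
  · subst h7
    have := W3 (W_mul l (hl (k, s)) (xm (m, v) (k, u)))
    simpa only [mul_assoc] using this
  have h8 : u = !s := by cases u <;> cases s <;> simp_all
  have h9 : v = !t := by cases v <;> cases t <;> simp_all
  subst h8 h9
  cases k <;> cases m
  · exact absurd rfl h4
  · simpa only [mul_assoc] using t4 s t
  · apply eqTr_comm
    have := t4 t (!s)
    simpa only [mul_assoc, Bool.not_not] using this
  · exact absurd rfl h4

include hinv hd1 hd2 t1 t2 t4 in
theorem W5_le : Wsp l ^ 5 ≤ Wsp l ^ 4 := by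
  have W4 := W4_le l hinv hd1 hd2 t1 t2 t4
  apply W_succ_le l le_rfl
  intro w hw
  match w, hw with
  | [(i, s), (j, t), (k, u), (m, v), (n, z)], _ =>
  simp only [List.map_cons, List.map_nil, List.prod_cons, List.prod_nil, mul_one]
  have sm := same_mem l hinv hd1 hd2 t1
  have xm := xux_mem l hinv hd1 hd2 t1 t2
  have hl := l_mem_W1 l
  have h2m : ∀ a b, l a * l b ∈ Wsp l ^ 2 := fun a b => W_mul l (hl a) (hl b)
  by_cases h1 : j = i
  · subst h1
    have := W_mul l (sm j s t) (W_mul l (hl (k, u)) (h2m (m, v) (n, z)))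
    simpa only [mul_assoc] using this
  by_cases h2 : k = j
  · subst h2
    have := W_mul l (hl (i, s)) (W_mul l (sm k t u) (h2m (m, v) (n, z)))
    simpa only [mul_assoc] using this
  have h3 : k = i := by cases i <;> cases j <;> cases k <;> simp_all
  subst h3
  by_cases h4 : m = k
  · subst h4
    have := W_mul l (h2m (m, s) (j, t)) (W_mul l (sm m u v) (hl (n, z)))
    simpa only [mul_assoc] using this
  have h5 : m = j := by cases m <;> cases j <;> cases k <;> simp_all
  subst h5
  by_cases h4 : n = m
  · subst h4
    have := W_mul l (h2m (k, s) (n, t)) (W_mul l (hl (k, u)) (sm n v z))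
    simpa only [mul_assoc] using this
  have h5 : n = k := by cases m <;> cases n <;> cases k <;> simp_all
  subst h5
  by_cases h6 : u = s
  · subst h6
    have := W_mul l (xm (n, u) (m, t)) (h2m (m, v) (n, z))
    simpa only [mul_assoc] using this
  by_cases h7 : v = t
  · subst h7
    have := W_mul l (hl (n, s)) (W_mul l (xm (m, v) (n, u)) (hl (n, z)))
    simpa only [mul_assoc] using this
  by_cases h8 : z = u
  · subst h8
    have := W_mul l (h2m (n, s) (m, t)) (xm (n, z) (m, v))
    simpa only [mul_assoc] using this
  have h8 : z = s := by cases u <;> cases s <;> cases z <;> simp_all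
  subst h8
  have hu3 : l (m, t) * l (n, u) * l (m, v) ∈ Wsp l ^ 3 := W_mul l (h2m _ _) (hl _)
  have hu4 : l (m, t) * l (n, u) * l (m, v) ∈ Wsp l ^ 4 := W_mono l (by norm_num) hu3
  have hl4 : ∀ a, l a ∈ Wsp l ^ 4 := fun a => W_mono l (by norm_num) (hl a)
  have e : ∀ a, l a * (l (m, t) * l (n, u) * l (m, v)) ∈ Wsp l ^ 4 := fun a => W_mul l (hl a) hu3
  have e' : ∀ a, (l (m, t) * l (n, u) * l (m, v)) * l a ∈ Wsp l ^ 4 := fun a => W_mul l hu3 (hl a)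
  have := pair_xux (hd1 _) (hd2 _) (hinv n z) (t1 _) (W4 hu4) (W4 (e _)) (W4 (e _)) _
    (one_mem_Wn l 4) (hl4 _) (hl4 _) hu4 (e _) (e' _)
  simpa only [mul_assoc] using this

include hinv hd1 hd2 t1 t2 t4 in
theorem adjoin_le : ∀ r ∈ Algebra.adjoin ℂ (Set.range l), r ∈ eqTr := by
  intro r hr
  apply W4_le l hinv hd1 hd2 t1 t2 t4
  have hr' : r ∈ Subalgebra.toSubmodule (Algebra.adjoin ℂ (Set.range l)) := hr
  rw [Algebra.adjoin_eq_span] at hr'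
  refine (Submodule.span_le.2 ?_) hr'
  intro x hx
  induction hx using Submonoid.closure_induction_right with
  | one => exact one_mem_Wn l 4
  | mul_right x _ y hy ih =>
    obtain ⟨a, rfl⟩ := hy
    exact W5_le l hinv hd1 hd2 t1 t2 t4 (W_mul l ih (l_mem_W1 l a))

end words

/-- Schur: an endomorphism commuting with an irreducible set is scalar. -/
theorem schur3 {T : Set M3}
    (hT : ∀ W : Submodule ℂ (Fin 3 → ℂ), (∀ m ∈ T, ∀ v ∈ W, m *ᵥ v ∈ W) → W = ⊥ ∨ W = ⊤)
    (f : (Fin 3 → ℂ) →ₗ[ℂ] (Fin 3 → ℂ)) (hf : ∀ m ∈ T, ∀ v, f (m *ᵥ v) = m *ᵥ f v) :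
    ∃ c : ℂ, ∀ v, f v = c • v := by
  obtain ⟨c, hc⟩ := Module.End.exists_eigenvalue f
  refine ⟨c, ?_⟩
  rcases hT (Module.End.eigenspace f c) (by
    intro m hm v hv
    rw [Module.End.mem_eigenspace_iff] at hv ⊢
    rw [hf m hm, hv, Matrix.mulVec_smul]) with h | h
  · exact absurd h hc
  · intro v
    exact Module.End.mem_eigenspace_iff.1 (h ▸ Submodule.mem_top)

theorem burnside3 (S : Subalgebra ℂ M3)
    (hS : ∀ W : Submodule ℂ (Fin 3 → ℂ), (∀ m ∈ S, ∀ v ∈ W, m *ᵥ v ∈ W) → W = ⊥ ∨ W = ⊤) :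
    S = ⊤ := by
  let S' : Subalgebra ℂ (Module.End ℂ (Fin 3 → ℂ)) :=
    S.map (Matrix.toLinAlgEquiv' (R := ℂ) (n := Fin 3)).toAlgHom
  have hmem : ∀ m ∈ S, Matrix.toLinAlgEquiv' m ∈ S' := fun m hm => ⟨m, hm, rfl⟩
  have hsimple : IsSimpleModule S' (Fin 3 → ℂ) := by
    rw [isSimpleModule_iff]
    refine { exists_pair_ne := ⟨⊥, ⊤, bot_ne_top⟩, eq_bot_or_eq_top := ?_ }
    intro W
    rcases hS (W.restrictScalars ℂ) (fun m hm v hv => W.smul_mem ⟨_, hmem m hm⟩ hv) with h | h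
    · left; simpa using h
    · right; simpa using h
  rw [eq_top_iff]
  intro m _
  let f : Module.End (Module.End S' (Fin 3 → ℂ)) (Fin 3 → ℂ) :=
    { toFun := fun v => m *ᵥ v
      map_add' := fun v w => Matrix.mulVec_add _ _ _
      map_smul' := by
        intro φ v
        obtain ⟨c, hc⟩ := schur3 (T := S) hS (φ.restrictScalars ℂ) (by
          intro n hn v
          exact φ.map_smul ⟨_, hmem n hn⟩ v)
        have hc' : ∀ v, φ v = c • v := hc
        simp only [Module.End.smul_def, hc', RingHom.id_apply, Matrix.mulVec_smul] }
  obtain ⟨⟨_, n, hn, rfl⟩, hr⟩ := jacobson_density (R := S') (M := Fin 3 → ℂ) f (Finset.univ.image fun i : Fin 3 => Pi.single i (1 : ℂ))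
  have : m = n := by
    apply Matrix.toLin'.injective
    apply LinearMap.pi_ext'
    intro i
    ext1
    have := hr (Pi.single i 1) (by simp)
    exact this
  rw [this]; exact hn

theorem trace_mul_eq_zero3 {m : M3} (h : ∀ n : M3, (m * n).trace = 0) : m = 0 := by
  ext i j
  have := h (Matrix.single j i 1)
  simpa [Matrix.trace_mul_single] using this

theorem conj_of_pairs (S : Subalgebra ℂ (M3 × M3)) (htr : ∀ r ∈ S, r ∈ eqTr)
    (h1 : S.map (AlgHom.fst ℂ M3 M3) = ⊤) (h2 : S.map (AlgHom.snd ℂ M3 M3) = ⊤) :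
    ∃ P : GL (Fin 3) ℂ, ∀ r ∈ S, r.2 = P * r.1 * (P⁻¹ : GL (Fin 3) ℂ) := by
  have s1 : ∀ m : M3, ∃ n, (m, n) ∈ S := by
    intro m
    have : m ∈ S.map (AlgHom.fst ℂ M3 M3) := h1 ▸ Algebra.mem_top
    obtain ⟨⟨a, b⟩, hr, rfl⟩ := this
    exact ⟨b, hr⟩
  have s2 : ∀ n : M3, ∃ m, (m, n) ∈ S := by
    intro m
    have : m ∈ S.map (AlgHom.snd ℂ M3 M3) := h2 ▸ Algebra.mem_top
    obtain ⟨⟨a, b⟩, hr, rfl⟩ := this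
    exact ⟨a, hr⟩
  have k1 : ∀ n, ((0 : M3), n) ∈ S → n = 0 := by
    intro n hn
    apply trace_mul_eq_zero3
    intro k
    obtain ⟨k', hk⟩ := s2 k
    have := htr _ (S.mul_mem hn hk)
    rw [mem_eqTr] at this
    simpa using this.symm
  have k2 : ∀ n, (n, (0 : M3)) ∈ S → n = 0 := by
    intro n hn
    apply trace_mul_eq_zero3
    intro k
    obtain ⟨k', hk⟩ := s1 k
    have := htr _ (S.mul_mem hn hk)
    rw [mem_eqTr] at this
    simpa using this
  let p1 : S →ₐ[ℂ] M3 := (AlgHom.fst ℂ M3 M3).comp S.val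
  let p2 : S →ₐ[ℂ] M3 := (AlgHom.snd ℂ M3 M3).comp S.val
  have b1 : Function.Bijective p1 := by
    refine ⟨(injective_iff_map_eq_zero p1).2 ?_, fun m => ?_⟩
    · rintro ⟨⟨a, b⟩, hr⟩ h
      have h : a = 0 := h
      subst h
      have := k1 _ hr
      subst this
      rfl
    · obtain ⟨n, hn⟩ := s1 m
      exact ⟨⟨_, hn⟩, rfl⟩
  have b2 : Function.Bijective p2 := by
    refine ⟨(injective_iff_map_eq_zero p2).2 ?_, fun m => ?_⟩
    · rintro ⟨⟨a, b⟩, hr⟩ h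
      have h : b = 0 := h
      subst h
      have := k2 _ hr
      subst this
      rfl
    · obtain ⟨n, hn⟩ := s2 m
      exact ⟨⟨_, hn⟩, rfl⟩
  let e1 := AlgEquiv.ofBijective p1 b1
  let e2 := AlgEquiv.ofBijective p2 b2
  let L : M3 ≃ₐ[ℂ] Module.End ℂ (Fin 3 → ℂ) := Matrix.toLinAlgEquiv' (R := ℂ) (n := Fin 3)
  obtain ⟨T, hT⟩ := AlgEquiv.eq_linearEquivConjAlgEquiv
    (L.symm.trans (e1.symm.trans (e2.trans L)))
  have hT' : ∀ r ∈ S, L r.2 ∘ₗ T.toLinearMap = T.toLinearMap ∘ₗ L r.1 := by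
    intro r hr
    have a1 : e1 ⟨r, hr⟩ = r.1 := rfl
    have a2 : e2 ⟨r, hr⟩ = r.2 := rfl
    have := congrArg (fun F => F (L r.1)) hT
    simp only [AlgEquiv.trans_apply, AlgEquiv.symm_apply_apply] at this
    rw [← a1, AlgEquiv.symm_apply_apply, a1, a2] at this
    rw [this]
    ext v
    simp [LinearEquiv.conjAlgEquiv_apply]
  let P : GL (Fin 3) ℂ := ⟨L.symm T.toLinearMap, L.symm T.symm.toLinearMap, by
      rw [← map_mul, ← map_one L.symm]; congr 1; exact LinearMap.ext fun v => T.apply_symm_apply v, by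
      rw [← map_mul, ← map_one L.symm]; congr 1; exact LinearMap.ext fun v => T.symm_apply_apply v⟩
  refine ⟨P, fun r hr => ?_⟩
  have hP : (P : M3) = L.symm T.toLinearMap := rfl
  have key : r.2 * (P : M3) = P * r.1 := by
    apply L.injective
    rw [map_mul, map_mul, hP, AlgEquiv.apply_symm_apply]
    exact hT' r hr
  rw [← key, mul_assoc, ← Units.val_mul, mul_inv_cancel, Units.val_one, mul_one]

theorem formJ_det : formJ.det = -1 := by
  simp [formJ, Matrix.det_diagonal, Fin.prod_univ_three]

theorem formJ_herm : formJᴴ = formJ := by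
  rw [formJ, Matrix.diagonal_conjTranspose]
  congr 1
  ext i
  fin_cases i <;> simp

theorem SU21.left_inv {X : M3} (h : SU21 X) : formJ * Xᴴ * formJ * X = 1 := by
  rw [mul_assoc, mul_assoc, ← mul_assoc Xᴴ, h.2, formJ_sq]

theorem SU21.trace_inv {X Y : M3} (h : SU21 X) (hXY : X * Y = 1) : Y.trace = star X.trace := by
  have e : Y = formJ * Xᴴ * formJ := by
    calc Y = (formJ * Xᴴ * formJ * X) * Y := by rw [h.left_inv, one_mul]
      _ = _ := by rw [mul_assoc, hXY, mul_one]
  rw [e, Matrix.trace_mul_comm, ← mul_assoc, formJ_sq, one_mul, Matrix.trace_conjTranspose]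

theorem scale_to_SU21 {G : Type*} [Group G] (ρ ρ' : G →* GL (Fin 3) ℂ)
    (hρ : ∀ g, SU21 ((ρ g : Matrix (Fin 3) (Fin 3) ℂ)))
    (hρ' : ∀ g, SU21 ((ρ' g : Matrix (Fin 3) (Fin 3) ℂ)))
    (hirr : IsIrreducibleRep ρ) (P : GL (Fin 3) ℂ) (hP : ∀ g, ρ' g = P * ρ g * P⁻¹) :
    ∃ Q : GL (Fin 3) ℂ, SU21 (Q : M3) ∧ ∀ g, ρ' g = Q * ρ g * Q⁻¹ := by
  have hdet : (P : M3).det ≠ 0 := (Matrix.isUnits_det_units P).ne_zero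
  obtain ⟨μ, hμ⟩ := IsAlgClosed.exists_pow_nat_eq ((P : M3).det)⁻¹ (n := 3) (by norm_num)
  have hμ0 : μ ≠ 0 := by
    rintro rfl
    have := inv_ne_zero hdet
    rw [← hμ] at this
    simp at this
  let Q : GL (Fin 3) ℂ := ⟨μ • (P : M3), μ⁻¹ • ((P⁻¹ : GL (Fin 3) ℂ) : M3), by
    rw [smul_mul_smul_comm, mul_inv_cancel₀ hμ0, one_smul, ← Units.val_mul, mul_inv_cancel,
      Units.val_one], by
    rw [smul_mul_smul_comm, inv_mul_cancel₀ hμ0, one_smul, ← Units.val_mul, inv_mul_cancel,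
      Units.val_one]⟩
  have hQ : (Q : M3) = μ • (P : M3) := rfl
  have hQd : (Q : M3).det = 1 := by
    rw [hQ, Matrix.det_smul, Fintype.card_fin, hμ, inv_mul_cancel₀ hdet]
  have hQc : ∀ g, (ρ' g : M3) * Q = Q * (ρ g : M3) := by
    intro g
    have : ρ' g * P = P * ρ g := by rw [hP g]; group
    have := congrArg (Units.val) this
    rw [Units.val_mul, Units.val_mul] at this
    rw [hQ, mul_smul_comm, smul_mul_assoc, this]
  have hQg : ∀ g, ρ' g = Q * ρ g * Q⁻¹ := by
    intro g
    rw [eq_mul_inv_iff_mul_eq]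
    exact Units.ext (hQc g)
  refine ⟨Q, ⟨hQd, ?_⟩, hQg⟩
  set H : M3 := (Q : M3)ᴴ * formJ * Q with hH
  have hHg : ∀ g, (ρ g : M3)ᴴ * H * (ρ g : M3) = H := by
    intro g
    calc (ρ g : M3)ᴴ * H * (ρ g : M3) = ((Q : M3) * (ρ g : M3))ᴴ * formJ * (Q * (ρ g : M3)) := by
          rw [hH, Matrix.conjTranspose_mul]; simp only [mul_assoc]
      _ = (Q : M3)ᴴ * ((ρ' g : M3)ᴴ * formJ * (ρ' g : M3)) * Q := by
          rw [← hQc, Matrix.conjTranspose_mul]; simp only [mul_assoc]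
      _ = H := by rw [(hρ' g).2]
  have hcomm : ∀ g, (formJ * H) * (ρ g : M3) = (ρ g : M3) * (formJ * H) := by
    intro g
    have hl := (hρ g).left_inv
    have hr : (ρ g : M3) * (formJ * (ρ g : M3)ᴴ * formJ) = 1 := mul_eq_one_comm.1 hl
    calc (formJ * H) * (ρ g : M3)
        = ((ρ g : M3) * (formJ * (ρ g : M3)ᴴ * formJ)) * ((formJ * H) * (ρ g : M3)) := by
          rw [hr, one_mul]
      _ = (ρ g : M3) * (formJ * ((ρ g : M3)ᴴ * ((formJ * formJ) * H) * (ρ g : M3))) := by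
          simp only [mul_assoc]
      _ = _ := by rw [formJ_sq, one_mul, hHg]
  obtain ⟨c, hc⟩ := schur3 (T := Set.range fun g => (ρ g : M3)) (by
      intro W hW
      exact hirr W fun g v hv => hW _ ⟨g, rfl⟩ v hv) (Matrix.toLin' (formJ * H)) (by
      rintro _ ⟨g, rfl⟩ v
      simp only [Matrix.toLin'_apply, Matrix.mulVec_mulVec, hcomm])
  have hJH : formJ * H = c • (1 : M3) := by
    apply Matrix.toLin'.injective
    refine LinearMap.ext fun v => ?_
    rw [hc]
    simp
  have hHc : H = c • formJ := by
    calc H = formJ * (formJ * H) := by rw [← mul_assoc, formJ_sq, one_mul]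
      _ = _ := by rw [hJH, mul_smul_comm, mul_one]
  have hc3 : c ^ 3 = 1 := by
    have : H.det = -1 := by
      rw [hH, Matrix.det_mul, Matrix.det_mul, Matrix.det_conjTranspose, hQd, formJ_det]; simp
    rw [hHc, Matrix.det_smul, formJ_det, Fintype.card_fin] at this
    linear_combination -this
  have hHh : Hᴴ = H := by
    rw [hH, Matrix.conjTranspose_mul, Matrix.conjTranspose_mul, Matrix.conjTranspose_conjTranspose,
      formJ_herm, mul_assoc]
  have hcr : star c = c := by
    rw [hHc, Matrix.conjTranspose_smul, formJ_herm] at hHh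
    have := congrFun (congrFun hHh 0) 0
    simpa [formJ] using this
  have hre : (c.re : ℂ) = c := Complex.conj_eq_iff_re.1 hcr
  have hc1 : c = 1 := by
    rw [← hre] at hc3 ⊢
    have h3 : c.re ^ 3 = 1 := by exact_mod_cast hc3
    have : c.re = 1 := by nlinarith [sq_nonneg (c.re + 1), sq_nonneg c.re,
      (show (c.re - 1) * (c.re ^ 2 + c.re + 1) = 0 by linear_combination h3)]
    rw [this]; simp
  rw [hHc, hc1, one_smul]

section group
variable (p q r : ℕ) (a b c : ℤ)

def bOf (j : Fin 4) : BrieskornGroup p q r a b c := PresentedGroup.of j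

theorem brieskorn_generated (H : Subgroup (BrieskornGroup p q r a b c))
    (h : ∀ j, bOf p q r a b c j ∈ H) (x : BrieskornGroup p q r a b c) : x ∈ H :=
  PresentedGroup.generated_by (brieskornRels p q r a b c) H h x

theorem bZ_eq : bOf p q r a b c 2 = (bX p q r a b c * bY p q r a b c)⁻¹ := by
  rw [eq_inv_iff_mul_eq_one, mul_eq_one_comm]
  exact PresentedGroup.one_of_mem (rels := brieskornRels p q r a b c)
    (x := FreeGroup.of 0 * FreeGroup.of 1 * FreeGroup.of 2) (by simp [brieskornRels])

theorem bH_comm (j : Fin 4) :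
    bH p q r a b c * bOf p q r a b c j = bOf p q r a b c j * bH p q r a b c := by
  by_cases hj : j = 3
  · subst hj; rfl
  · rw [← mul_inv_eq_one, _root_.mul_inv_rev, ← mul_assoc]
    have : FreeGroup.of 3 * FreeGroup.of j * (FreeGroup.of 3)⁻¹ * (FreeGroup.of j)⁻¹ ∈
        brieskornRels p q r a b c := by
      fin_cases j <;> simp [brieskornRels] at hj ⊢
    exact PresentedGroup.one_of_mem this

theorem bH_central (g : BrieskornGroup p q r a b c) :
    g * bH p q r a b c = bH p q r a b c * g := by
  have := brieskorn_generated p q r a b c (Subgroup.centralizer {bH p q r a b c}) (by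
    intro j
    rw [Subgroup.mem_centralizer_singleton_iff]
    exact (bH_comm p q r a b c j).symm) g
  exact Subgroup.mem_centralizer_singleton_iff.1 this

end group

theorem trace_conj_GL (P A : GL (Fin 3) ℂ) :
    (((P * A * P⁻¹ : GL (Fin 3) ℂ)) : M3).trace = (A : M3).trace := by
  rw [Units.val_mul, Matrix.trace_mul_comm, ← Units.val_mul]
  congr 2
  group


section pairs
variable {G : Type*} [Group G] (ρ ρ' : G →* GL (Fin 3) ℂ)

def prPair (g : G) : M3 × M3 := ((ρ g : M3), (ρ' g : M3))

theorem prPair_mul (g h : G) : prPair ρ ρ' g * prPair ρ ρ' h = prPair ρ ρ' (g * h) := by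
  simp [prPair]

theorem prPair_one : prPair ρ ρ' 1 = 1 := by
  simp [prPair]

theorem val_mul_inv (ρ : G →* GL (Fin 3) ℂ) (g : G) : (ρ g : M3) * (ρ g⁻¹ : M3) = 1 := by
  rw [← Units.val_mul, ← map_mul, mul_inv_cancel, map_one, Units.val_one]

theorem val_mul3 (ρ : G →* GL (Fin 3) ℂ) (g h : G) : (ρ g : M3) * (ρ h : M3) = (ρ (g * h) : M3) := by
  rw [map_mul, Units.val_mul]

variable (hρ : ∀ g, SU21 ((ρ g : Matrix (Fin 3) (Fin 3) ℂ)))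
    (hρ' : ∀ g, SU21 ((ρ' g : Matrix (Fin 3) (Fin 3) ℂ)))

include hρ hρ' in
theorem prPair_inv {g : G} (h : prPair ρ ρ' g ∈ eqTr) : prPair ρ ρ' g⁻¹ ∈ eqTr := by
  rw [mem_eqTr] at h ⊢
  simp only [prPair] at h ⊢
  rw [(hρ g).trace_inv (val_mul_inv ρ g), (hρ' g).trace_inv (val_mul_inv ρ' g), h]

theorem prPair_comm {g h : G} (H : prPair ρ ρ' (g * h) ∈ eqTr) : prPair ρ ρ' (h * g) ∈ eqTr := by
  rw [← prPair_mul] at H ⊢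
  exact eqTr_comm H

theorem prPair_of_conj {g : G} (h : ConjInSU21 (ρ g) (ρ' g)) : prPair ρ ρ' g ∈ eqTr := by
  obtain ⟨P, -, hP⟩ := h
  rw [mem_eqTr]
  simp only [prPair]
  rw [hP, trace_conj_GL]

include hρ hρ' in
theorem comm_eq {x y : G} (hx : prPair ρ ρ' x ∈ eqTr) (hy : prPair ρ ρ' y ∈ eqTr)
    (hxy : prPair ρ ρ' (x * y) ∈ eqTr) (hxy' : prPair ρ ρ' (x⁻¹ * y) ∈ eqTr)
    (him : ((ρ (x * y * x⁻¹ * y⁻¹) : M3).trace).im = ((ρ' (x * y * x⁻¹ * y⁻¹) : M3).trace).im) :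
    prPair ρ ρ' (x * y * x⁻¹ * y⁻¹) ∈ eqTr := by
  have inv := fun {g : G} => prPair_inv ρ ρ' hρ hρ' (g := g)
  have h1 := inv hx
  have h2 := inv hy
  have h3 := inv (prPair_comm ρ ρ' hxy)
  have h4 := prPair_comm ρ ρ' hxy'
  have h5 := inv hxy'
  rw [_root_.mul_inv_rev] at h3 h5
  rw [inv_inv] at h5
  have h5 := prPair_comm ρ ρ' h5
  have s1 := M3.comm_sum (val_mul_inv ρ x) (val_mul_inv ρ y)
  have s2 := M3.comm_sum (val_mul_inv ρ' x) (val_mul_inv ρ' y)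
  have i1 := (hρ (x * y * x⁻¹ * y⁻¹)).trace_inv (val_mul_inv ρ _)
  have i2 := (hρ' (x * y * x⁻¹ * y⁻¹)).trace_inv (val_mul_inv ρ' _)
  have e : (x * y * x⁻¹ * y⁻¹)⁻¹ = y * x * y⁻¹ * x⁻¹ := by group
  rw [e] at i1 i2
  simp only [val_mul3] at s1 s2
  rw [i1] at s1
  rw [i2] at s2
  simp only [mem_eqTr, prPair] at hx hy hxy h1 h2 h3 h4 h5 ⊢
  rw [hx, hy, hxy, h1, h2, h3, h4, h5, ← s2] at s1
  have hre := congrArg Complex.re s1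
  simp only [Complex.add_re, Complex.star_def, Complex.conj_re] at hre
  exact Complex.ext (by linarith) him

end pairs

theorem su21_reps_of_brieskorn_conjugate_iff
    (p q r : ℕ) (hp : 0 < p) (hq : 0 < q) (hr : 0 < r)
    (hpq : Nat.Coprime p q) (hqr : Nat.Coprime q r) (hpr : Nat.Coprime p r)
    (a b c : ℤ)
    (habc : (a : ℚ) / p + (b : ℚ) / q + (c : ℚ) / r = 1 / ((p : ℚ) * q * r))
    (ρ ρ' : BrieskornGroup p q r a b c →* GL (Fin 3) ℂ)
    (hρ : ∀ g, SU21 ((ρ g : Matrix (Fin 3) (Fin 3) ℂ)))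
    (hρ' : ∀ g, SU21 ((ρ' g : Matrix (Fin 3) (Fin 3) ℂ)))
    (hirr : IsIrreducibleRep ρ) (hirr' : IsIrreducibleRep ρ') :
    (∃ P : GL (Fin 3) ℂ, SU21 (P : Matrix (Fin 3) (Fin 3) ℂ) ∧
        ∀ g, ρ' g = P * ρ g * P⁻¹) ↔
      (ConjInSU21 (ρ (bX p q r a b c)) (ρ' (bX p q r a b c)) ∧
       ConjInSU21 (ρ (bY p q r a b c)) (ρ' (bY p q r a b c)) ∧
       ConjInSU21 (ρ (bH p q r a b c)) (ρ' (bH p q r a b c)) ∧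
       Matrix.trace ((ρ (bX p q r a b c * bY p q r a b c) : Matrix (Fin 3) (Fin 3) ℂ)) =
         Matrix.trace ((ρ' (bX p q r a b c * bY p q r a b c) : Matrix (Fin 3) (Fin 3) ℂ)) ∧
       Matrix.trace ((ρ ((bX p q r a b c)⁻¹ * bY p q r a b c) : Matrix (Fin 3) (Fin 3) ℂ)) =
         Matrix.trace ((ρ' ((bX p q r a b c)⁻¹ * bY p q r a b c) : Matrix (Fin 3) (Fin 3) ℂ)) ∧
       (Matrix.trace ((ρ (bX p q r a b c * bY p q r a b c * (bX p q r a b c)⁻¹ *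
           (bY p q r a b c)⁻¹) : Matrix (Fin 3) (Fin 3) ℂ))).im =
         (Matrix.trace ((ρ' (bX p q r a b c * bY p q r a b c * (bX p q r a b c)⁻¹ *
           (bY p q r a b c)⁻¹) : Matrix (Fin 3) (Fin 3) ℂ))).im) := by
  constructor
  · rintro ⟨P, hP, h⟩
    exact ⟨⟨P, hP, h _⟩, ⟨P, hP, h _⟩, ⟨P, hP, h _⟩, by rw [h, trace_conj_GL],
      by rw [h, trace_conj_GL], by rw [h, trace_conj_GL]⟩
  rintro ⟨cx, cy, ch, txy, txy', him⟩
  generalize hX : bX p q r a b c = X at *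
  generalize hY : bY p q r a b c = Y at *
  have inv := fun {g : BrieskornGroup p q r a b c} => prPair_inv ρ ρ' hρ hρ' (g := g)
  have hx := prPair_of_conj ρ ρ' cx
  have hy := prPair_of_conj ρ ρ' cy
  have hxy : prPair ρ ρ' (X * Y) ∈ eqTr := txy
  have hxy' : prPair ρ ρ' (X⁻¹ * Y) ∈ eqTr := txy'
  have hC := comm_eq ρ ρ' hρ hρ' hx hy hxy hxy' him
  let gg : Bool × Bool → BrieskornGroup p q r a b c := fun u =>
    if u.2 then (if u.1 then Y else X)⁻¹ else (if u.1 then Y else X)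
  let l : Bool × Bool → M3 × M3 := fun u => prPair ρ ρ' (gg u)
  have hS : ∀ s ∈ Algebra.adjoin ℂ (Set.range l), s ∈ eqTr := by
    apply adjoin_le l
    · intro i s
      simp only [l, prPair_mul]
      have : gg (i, s) * gg (i, !s) = 1 := by cases i <;> cases s <;> simp [gg]
      rw [this, prPair_one]
    · exact fun u => (hρ _).1
    · exact fun u => (hρ' _).1
    · rintro ⟨i, s⟩
      cases i <;> cases s
      · exact hx
      · exact inv hx
      · exact hy
      · exact inv hy
    · intro s t
      simp only [l, prPair_mul]
      cases s <;> cases t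
      · exact hxy
      · have := inv hxy'
        rw [_root_.mul_inv_rev, inv_inv] at this
        exact prPair_comm ρ ρ' this
      · exact hxy'
      · have := inv (prPair_comm ρ ρ' hxy)
        rw [_root_.mul_inv_rev] at this
        exact this
    · intro s t
      simp only [l, prPair_mul]
      have hC' := inv hC
      cases s <;> cases t
      · exact hC
      · have e : (X * Y * X⁻¹ * Y⁻¹)⁻¹ = Y * (X * Y⁻¹ * X⁻¹) := by group
        rw [e] at hC'
        simpa [gg] using prPair_comm ρ ρ' hC'
      · have e : (X * Y * X⁻¹ * Y⁻¹)⁻¹ = (Y * X * Y⁻¹) * X⁻¹ := by group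
        rw [e] at hC'
        have := prPair_comm ρ ρ' hC'
        simpa [gg, mul_assoc] using this
      · have e : X * Y * X⁻¹ * Y⁻¹ = (X * Y) * (X⁻¹ * Y⁻¹) := by group
        rw [e] at hC
        have := prPair_comm ρ ρ' hC
        simpa [gg, mul_assoc] using this
  set S := Algebra.adjoin ℂ (Set.range l) with hSdef
  have hl : ∀ u, prPair ρ ρ' (gg u) ∈ S := fun u => Algebra.subset_adjoin ⟨u, rfl⟩
  -- the central element
  obtain ⟨k, hk⟩ : ∃ k : ℂ, prPair ρ ρ' (bH p q r a b c) = k • 1 := by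
    obtain ⟨k, hk⟩ := schur3 (T := Set.range fun g => (ρ g : M3)) (by
      intro W hW
      exact hirr W fun g v hv => hW _ ⟨g, rfl⟩ v hv)
      (Matrix.toLin' (ρ (bH p q r a b c) : M3)) (by
      rintro _ ⟨g, rfl⟩ v
      simp only [Matrix.toLin'_apply, Matrix.mulVec_mulVec, val_mul3, bH_central])
    have hk' : (ρ (bH p q r a b c) : M3) = k • (1 : M3) := by
      apply Matrix.toLin'.injective
      refine LinearMap.ext fun v => ?_
      rw [hk]
      simp
    refine ⟨k, Prod.ext hk' ?_⟩
    obtain ⟨P, -, hP⟩ := ch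
    simp only [prPair, hP, Units.val_mul, hk', mul_smul_comm, smul_mul_assoc, mul_one]
    rw [← Units.val_mul, mul_inv_cancel, Units.val_one]
    rfl
  have hk0 : k ≠ 0 := by
    rintro rfl
    have := prPair_mul ρ ρ' (bH p q r a b c) (bH p q r a b c)⁻¹
    rw [hk, zero_smul, zero_mul, mul_inv_cancel, prPair_one] at this
    exact zero_ne_one this
  have hkinv : prPair ρ ρ' (bH p q r a b c)⁻¹ = k⁻¹ • 1 := by
    have := prPair_mul ρ ρ' (bH p q r a b c) (bH p q r a b c)⁻¹
    rw [hk, mul_inv_cancel, prPair_one, smul_mul_assoc, one_mul] at this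
    rw [← this, smul_smul, inv_mul_cancel₀ hk0, one_smul]
  let HH : Subgroup (BrieskornGroup p q r a b c) :=
    { carrier := {g | prPair ρ ρ' g ∈ S ∧ prPair ρ ρ' g⁻¹ ∈ S}
      one_mem' := by
        constructor
        · rw [prPair_one]; exact S.one_mem
        · rw [inv_one, prPair_one]; exact S.one_mem
      mul_mem' := by
        rintro g h ⟨h1, h2⟩ ⟨h3, h4⟩
        constructor
        · rw [← prPair_mul]; exact S.mul_mem h1 h3
        · rw [_root_.mul_inv_rev, ← prPair_mul]; exact S.mul_mem h4 h2
      inv_mem' := by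
        rintro g ⟨h1, h2⟩
        exact ⟨h2, by rw [inv_inv]; exact h1⟩ }
  have hXm : X ∈ HH := ⟨hl (false, false), hl (false, true)⟩
  have hYm : Y ∈ HH := ⟨hl (true, false), hl (true, true)⟩
  have hHm : bH p q r a b c ∈ HH :=
    ⟨by rw [hk]; exact S.smul_mem S.one_mem _, by rw [hkinv]; exact S.smul_mem S.one_mem _⟩
  have hall : ∀ g, prPair ρ ρ' g ∈ S := by
    intro g
    have : g ∈ HH := by
      apply brieskorn_generated
      intro j
      fin_cases j
      · change bX p q r a b c ∈ HH
        rw [hX]; exact hXm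
      · change bY p q r a b c ∈ HH
        rw [hY]; exact hYm
      · change bOf p q r a b c 2 ∈ HH
        rw [bZ_eq, hX, hY]
        exact HH.inv_mem (HH.mul_mem hXm hYm)
      · exact hHm
    exact this.1
  obtain ⟨P, hP⟩ := conj_of_pairs S hS
    (burnside3 _ fun W hW => hirr W fun g v hv => hW _ ⟨_, hall g, rfl⟩ v hv)
    (burnside3 _ fun W hW => hirr' W fun g v hv => hW _ ⟨_, hall g, rfl⟩ v hv)
  refine scale_to_SU21 ρ ρ' hρ hρ' hirr P fun g => ?_
  exact Units.ext (hP _ (hall g))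
end
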